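/- Let n ≥ 2 and let 𝔠 be a big chamber of C(Φ⁺). Then for every λ = Σ_{i=1}^{n−1} a_i α_i with nonnegative integer coefficients such that λ ∈ 𝔠, the weighted Kostant sum satisfies S(λ) = (∏_{1≤i<j≤n} Ω_{i,j}) · Σ_{w ∈ W(𝔠)} (−1)^{ε(w)} q^{−D(w,λ)}, where W(𝔠) := {permutations w of {1,…,n} : 𝔠 ⊆ Cone(w)} and ∏_{1≤i<j≤n} Ω_{i,j} = (q−1)^n/(q^n−1). -/

import Mathlib

noncomputable def q : RatFunc ℚ := RatFunc.X

noncomputable def wt (r : ℕ) : RatFunc ℚ :=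
  if r = 0 then 1
  else q ^ (-(r : ℤ)) * (q - 1) ^ 2 * (q ^ (2 * r) - 1) / (q ^ 2 - 1)

noncomputable def Omega (i j : ℕ) : RatFunc ℚ :=
  if j - i = 1 then (q - 1) ^ 2 / (q ^ 2 - 1)
  else (q ^ (j - i) - 1) ^ 2 / ((q ^ (j - i - 1) - 1) * (q ^ (j - i + 1) - 1))

def rootZ (i j : ℕ) : ℕ → ℤ := fun k => (if k = i then 1 else 0) - (if k = j then 1 else 0)

def pairs (n : ℕ) : Finset (ℕ × ℕ) :=
  (Finset.Icc 1 n ×ˢ Finset.Icc 1 n).filter fun p => p.1 < p.2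

def IsKostant (n : ℕ) (lam : ℕ → ℤ) (r : ℕ × ℕ → ℕ) : Prop :=
  (∀ p ∉ pairs n, r p = 0) ∧
    (∑ p ∈ pairs n, (r p : ℤ) • rootZ p.1 p.2) = lam

/-- The weighted Kostant sum `S(λ)` (equal to the trace `τ(θ_{−λ})` by Opdam's formula). -/
noncomputable def S (n : ℕ) (lam : ℕ → ℤ) : RatFunc ℚ :=
  ∑ᶠ r ∈ {r : ℕ × ℕ → ℕ | IsKostant n lam r}, ∏ p ∈ pairs n, wt (r p)

noncomputable def rootR (i j : ℕ) : ℕ → ℝ := fun k => (if k = i then 1 else 0) - (if k = j then 1 else 0)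

def posRoots (n : ℕ) : Set (ℕ → ℝ) := {v | ∃ i j, 1 ≤ i ∧ i < j ∧ j ≤ n ∧ v = rootR i j}

def coneOf (T : Finset (ℕ → ℝ)) : Set (ℕ → ℝ) :=
  {v | ∃ c : (ℕ → ℝ) → ℝ, (∀ x ∈ T, 0 ≤ c x) ∧ v = ∑ x ∈ T, c x • x}

def conePos (n : ℕ) : Set (ℕ → ℝ) :=
  {v | ∃ T : Finset (ℕ → ℝ), ↑T ⊆ posRoots n ∧ v ∈ coneOf T}

def IsSingular (n : ℕ) (v : ℕ → ℝ) : Prop :=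
  ∃ T : Finset (ℕ → ℝ), ↑T ⊆ posRoots n ∧ T.card ≤ n - 2 ∧ v ∈ coneOf T

def regularSet (n : ℕ) : Set (ℕ → ℝ) := {v | v ∈ conePos n ∧ ¬ IsSingular n v}

noncomputable def absRoot (w : Equiv.Perm ℕ) (i : ℕ) : ℕ → ℝ :=
  rootR (min (w i) (w (i + 1))) (max (w i) (w (i + 1)))

def SB (a b : ℕ) : Set (Equiv.Perm ℕ) := {w | ∀ k ∉ Finset.Icc a b, w k = k}

/-- `Cone(w)`: the cone generated by `|w(α_1)|, …, |w(α_{n−1})|`. -/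
noncomputable def Cone (n : ℕ) (w : Equiv.Perm ℕ) : Set (ℕ → ℝ) :=
  {v | ∃ c : ℕ → ℝ, (∀ i ∈ Finset.Icc 1 (n - 1), 0 ≤ c i) ∧
      v = ∑ i ∈ Finset.Icc 1 (n - 1), c i • absRoot w i}

/-- `W(𝔠)`: permutations of `{1,…,n}` whose cone contains the chamber `𝔠`. -/
def Wc (n : ℕ) (cc : Set (ℕ → ℝ)) : Set (Equiv.Perm ℕ) :=
  {w | w ∈ SB 1 n ∧ cc ⊆ Cone n w}

def eps (n : ℕ) (w : Equiv.Perm ℕ) : ℕ :=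
  ((Finset.Icc 1 (n - 1)).filter fun i => w i < w (i + 1)).card

def D (N : ℕ) (w : Equiv.Perm ℕ) (a : ℕ → ℤ) : ℤ :=
  ∑ i ∈ Finset.Icc 1 N, a i * ((w⁻¹ (i + 1) : ℤ) - (w⁻¹ i : ℤ))


lemma q_ne_zero : (q : RatFunc ℚ) ≠ 0 := RatFunc.X_ne_zero

lemma q_pow_ne_one (k : ℕ) (hk : k ≠ 0) : (q : RatFunc ℚ) ^ k ≠ 1 := by
  intro h
  have h2 : (algebraMap (Polynomial ℚ) (RatFunc ℚ)) (Polynomial.X ^ k) =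
      algebraMap (Polynomial ℚ) (RatFunc ℚ) 1 := by
    rw [map_pow, RatFunc.algebraMap_X, map_one]; exact h
  have h3 := RatFunc.algebraMap_injective ℚ h2
  have := congrArg Polynomial.natDegree h3
  simp at this
  exact hk this

lemma q_sub_ne (k : ℕ) (hk : k ≠ 0) : (q : RatFunc ℚ) ^ k - 1 ≠ 0 :=
  sub_ne_zero.2 (q_pow_ne_one k hk)

lemma omega_prod_col (n : ℕ) :
    ∏ i ∈ Finset.Icc 1 (n + 1), Omega i (n + 2) = (q - 1) * (q ^ (n + 1) - 1) / (q ^ (n + 2) - 1) := by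
  have key : ∀ n, ∏ d ∈ Finset.range (n + 1), Omega 0 (d + 1)
      = (q - 1) * (q ^ (n + 1) - 1) / (q ^ (n + 2) - 1) := by
    intro n
    induction n with
    | zero => simp [Omega, pow_two]
    | succ n ih =>
      rw [Finset.prod_range_succ, ih]
      have h1 := q_sub_ne (n + 1) (by omega)
      have h2 := q_sub_ne (n + 2) (by omega)
      have h3 := q_sub_ne (n + 3) (by omega)
      have : Omega 0 (n + 1 + 1) = (q ^ (n + 2) - 1) ^ 2 / ((q ^ (n + 1) - 1) * (q ^ (n + 3) - 1)) := by
        simp [Omega]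
      rw [this]
      field_simp
  rw [← key n]
  refine Finset.prod_bij' (fun i _ => n + 1 - i) (fun d _ => n + 1 - d) ?_ ?_ ?_ ?_ ?_
  · intro i hi; simp at hi ⊢; omega
  · intro i hi; simp at hi ⊢; omega
  · intro i hi; simp at hi ⊢; omega
  · intro i hi; simp at hi ⊢; omega
  · intro i hi
    simp at hi
    have : n + 2 - i = n + 1 - i + 1 := by omega
    simp only [Omega, this, Nat.sub_zero]

lemma pairs_prod_succ {M : Type*} [CommMonoid M] (f : ℕ × ℕ → M) (n : ℕ) :
    ∏ p ∈ pairs (n + 1), f p = (∏ p ∈ pairs n, f p) * ∏ i ∈ Finset.Icc 1 n, f (i, n + 1) := by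
  have : pairs (n + 1) = pairs n ∪ (Finset.Icc 1 n).image (fun i => (i, n + 1)) := by
    ext ⟨i, j⟩
    simp [pairs]
    omega
  rw [this, Finset.prod_union, Finset.prod_image]
  · intro a _ b _ h
    simpa using h
  · rw [Finset.disjoint_left]
    rintro ⟨i, j⟩ h
    simp [pairs] at h ⊢
    omega

lemma omega_prod (n : ℕ) :
    (∏ p ∈ pairs (n + 1), Omega p.1 p.2) = (q - 1) ^ (n + 1) / (q ^ (n + 1) - 1) := by
  induction n with
  | zero =>
    have : pairs 1 = ∅ := by
      ext ⟨i, j⟩; simp [pairs]; omega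
    have h1 := q_sub_ne 1 (by omega)
    simp only [pow_one] at h1
    simp [this, h1]
  | succ n ih =>
    rw [pairs_prod_succ, ih, omega_prod_col]
    have h1 := q_sub_ne (n + 1) (by omega)
    have h2 := q_sub_ne (n + 2) (by omega)
    field_simp
    try ring

lemma cauchy_det {K : Type*} [Field K] (c : K) (hc : c ≠ 0) : ∀ (n : ℕ) (x : Fin n → K)
    (_ : ∀ i j, x i - c * x j ≠ 0),
    Matrix.det (Matrix.of fun i j => (1 - c) * x i / (x i - c * x j)) =
      ∏ i, ∏ j ∈ Finset.Ioi i, (x j - x i) ^ 2 / ((x j - c * x i) * (x j - c⁻¹ * x i)) := by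
  intro n
  induction n with
  | zero => intro x _; simp
  | succ n ih =>
    intro x hx
    have ih' := ih (fun i => x i.succ) (fun i j => hx _ _)
    rw [Fin.prod_univ_succ]
    simp only [Fin.prod_Ioi_succ, Fin.prod_Ioi_zero]
    rw [← ih']
    set G : Fin (n + 1) → Fin (n + 1) → K := fun i j => (1 - c) * x i / (x i - c * x j) with hG
    have hG0 : G 0 0 = 1 := by
      have := hx 0 0
      have h2 : x 0 - c * x 0 = (1 - c) * x 0 := by ring
      simp only [hG]
      rw [h2] at this ⊢
      exact div_self this
    rw [Matrix.det_eq_of_forall_row_eq_smul_add_const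
      (B := Matrix.of fun i j => G i j - (if i = 0 then 0 else G i 0) * G 0 j)
      (fun i => if i = 0 then 0 else G i 0) 0 (by simp) (by
        intro i j
        simp [hG])]
    rw [Matrix.det_succ_column_zero, Fin.sum_univ_succ]
    rw [Finset.sum_eq_zero (s := Finset.univ)]
    · simp only [Matrix.of_apply, hG0, Fin.val_zero, pow_zero, if_true, zero_mul, sub_zero, one_mul,
        add_zero]
      have e : (Matrix.of fun i j => G i j - (if i = 0 then 0 else G i 0) * G 0 j).submatrix
          (Fin.succAbove 0) Fin.succ = Matrix.of fun i j =>
            ((x (Fin.succ i) - x 0) / (x (Fin.succ i) - c * x 0)) *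
            (Matrix.of fun i j => ((x (Fin.succ j) - x 0) / (x (Fin.succ j) - c⁻¹ * x 0)) *
             (Matrix.of (fun i j : Fin n => (1 - c) * x i.succ / (x i.succ - c * x j.succ))) i j) i j := by
        ext i j
        simp only [Matrix.submatrix_apply, Matrix.of_apply, Fin.succAbove_zero, Fin.succ_ne_zero,
          if_false, hG]
        have h1 := hx i.succ j.succ
        have h2 := hx i.succ 0
        have h3 := hx 0 j.succ
        have h4 : x j.succ - c⁻¹ * x 0 = -c⁻¹ * (x 0 - c * x j.succ) := by
          field_simp; ring
        rw [h4]
        field_simp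
        ring
      rw [e, Matrix.det_mul_column, Matrix.det_mul_row, ← mul_assoc, ← Finset.prod_mul_distrib]
      congr 1
      apply Finset.prod_congr rfl
      intro i _
      rw [div_mul_div_comm, pow_two]
    · intro i _
      simp [hG0]

open Classical in
noncomputable def PSr (f : ℕ → RatFunc ℚ) (v : ℕ →₀ ℕ) : MvPowerSeries ℕ (RatFunc ℚ) :=
  fun d => if h : ∃ r : ℕ, d = r • v then f h.choose else 0

lemma smul_inj_fs {v : ℕ →₀ ℕ} (hv : v ≠ 0) {r s : ℕ} (h : r • v = s • v) : r = s := by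
  obtain ⟨k, hk⟩ := Finsupp.ne_iff.1 hv
  have := DFunLike.congr_fun h k
  simp at this
  rcases this with h | h
  · exact h
  · exact absurd h hk

lemma PSr_coeff_smul (f : ℕ → RatFunc ℚ) {v : ℕ →₀ ℕ} (hv : v ≠ 0) (r : ℕ) :
    MvPowerSeries.coeff (r • v) (PSr f v) = f r := by
  have h : ∃ s : ℕ, r • v = s • v := ⟨r, rfl⟩
  have h2 : MvPowerSeries.coeff (r • v) (PSr f v) = f h.choose := by
    change PSr f v (r • v) = _
    rw [PSr, dif_pos h]
  rw [h2, ← smul_inj_fs hv h.choose_spec]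

lemma PSr_coeff_of_not (f : ℕ → RatFunc ℚ) {v d : ℕ →₀ ℕ} (h : ¬ ∃ r : ℕ, d = r • v) :
    MvPowerSeries.coeff d (PSr f v) = 0 := by
  change PSr f v d = _
  rw [PSr, dif_neg h]

lemma PSr_geo (c : RatFunc ℚ) {v : ℕ →₀ ℕ} (hv : v ≠ 0) :
    PSr (fun r => c ^ r) v * (1 - MvPowerSeries.monomial v c) = 1 := by
  ext d
  rw [mul_sub, mul_one, map_sub, MvPowerSeries.coeff_mul_monomial, MvPowerSeries.coeff_one]
  by_cases h : ∃ r : ℕ, d = r • v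
  · obtain ⟨r, rfl⟩ := h
    rw [PSr_coeff_smul _ hv]
    cases r with
    | zero =>
      have : ¬ v ≤ 0 := by simpa using hv
      simp [this]
    | succ r =>
      have h1 : v ≤ (r + 1) • v := by
        rw [succ_nsmul]; exact le_add_self
      have h2 : (r + 1) • v - v = r • v := by
        rw [succ_nsmul, add_tsub_cancel_right]
      have h3 : (r + 1) • v ≠ 0 := by
        intro h
        have := smul_inj_fs hv (h.trans (zero_smul ℕ v).symm)
        omega
      rw [if_pos h1, h2, PSr_coeff_smul _ hv, if_neg h3]
      ring
  · rw [PSr_coeff_of_not _ h]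
    have h0 : d ≠ 0 := fun h0 => h ⟨0, by simp [h0]⟩
    rw [if_neg h0]
    split_ifs with hle
    · rw [PSr_coeff_of_not]
      · simp
      · rintro ⟨r, hr⟩
        exact h ⟨r + 1, by rw [succ_nsmul, ← hr, tsub_add_cancel_of_le hle]⟩
    · simp

lemma PSr_add (f g : ℕ → RatFunc ℚ) (v : ℕ →₀ ℕ) :
    PSr (fun r => f r + g r) v = PSr f v + PSr g v := by
  funext d
  change PSr _ v d = PSr f v d + PSr g v d
  unfold PSr
  split_ifs <;> simp

lemma PSr_smul (c : RatFunc ℚ) (f : ℕ → RatFunc ℚ) (v : ℕ →₀ ℕ) :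
    PSr (fun r => c * f r) v = c • PSr f v := by
  funext d
  change PSr _ v d = c * PSr f v d
  unfold PSr
  split_ifs <;> simp

lemma PSr_delta {v : ℕ →₀ ℕ} (hv : v ≠ 0) : PSr (fun r => if r = 0 then 1 else 0) v = 1 := by
  ext d
  rw [MvPowerSeries.coeff_one]
  by_cases h : ∃ r : ℕ, d = r • v
  · obtain ⟨r, rfl⟩ := h
    rw [PSr_coeff_smul _ hv]
    by_cases hr : r = 0
    · simp [hr]
    · rw [if_neg hr, if_neg]
      intro h
      exact hr (smul_inj_fs hv (h.trans (zero_smul ℕ v).symm))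
  · rw [PSr_coeff_of_not _ h, if_neg]
    rintro rfl
    exact h ⟨0, by simp⟩

lemma PSr_prod_coeff {ι : Type*} [DecidableEq ι] (s : Finset ι) (v : ι → (ℕ →₀ ℕ))
    (hv : ∀ i ∈ s, v i ≠ 0) (f : ι → ℕ → RatFunc ℚ) (d : ℕ →₀ ℕ) :
    MvPowerSeries.coeff d (∏ i ∈ s, PSr (f i) (v i)) =
      ∑ᶠ r ∈ {r : ι → ℕ | (∀ i ∉ s, r i = 0) ∧ ∑ i ∈ s, r i • v i = d}, ∏ i ∈ s, f i (r i) := by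
  classical
  rw [MvPowerSeries.coeff_prod]
  set T := (s.finsuppAntidiag d).filter (fun l => ∀ i ∈ s, ∃ r : ℕ, l i = r • v i) with hT
  have h1 : ∑ l ∈ s.finsuppAntidiag d, ∏ i ∈ s, MvPowerSeries.coeff (l i) (PSr (f i) (v i)) =
      ∑ l ∈ T, ∏ i ∈ s, MvPowerSeries.coeff (l i) (PSr (f i) (v i)) := by
    symm
    apply Finset.sum_subset (Finset.filter_subset _ _)
    intro l hl hl2
    have : ¬ ∀ i ∈ s, ∃ r : ℕ, l i = r • v i := fun h => hl2 (Finset.mem_filter.2 ⟨hl, h⟩)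
    push Not at this
    obtain ⟨i, hi, h⟩ := this
    apply Finset.prod_eq_zero hi
    apply PSr_coeff_of_not
    rintro ⟨r, hr⟩
    exact h r hr
  rw [h1, ← finsum_mem_coe_finset]
  symm
  refine finsum_mem_eq_of_bijOn (fun r => Finsupp.onFinset s (fun i => if i ∈ s then r i • v i else 0)
    (by intro i hi; by_contra h; simp [h] at hi)) ⟨?_, ?_, ?_⟩ ?_
  · rintro r ⟨hr0, hr⟩
    simp only [hT, Finset.coe_filter, Finset.mem_finsuppAntidiag, Set.mem_setOf_eq]
    refine ⟨⟨?_, ?_⟩, ?_⟩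
    · rw [← hr]
      apply Finset.sum_congr rfl
      intro i hi
      simp [hi]
    · exact Finsupp.support_onFinset_subset
    · intro i hi
      exact ⟨r i, by simp [hi]⟩
  · rintro r ⟨hr0, hr⟩ r' ⟨hr0', hr'⟩ h
    funext i
    by_cases hi : i ∈ s
    · have := DFunLike.congr_fun h i
      simp only [Finsupp.onFinset_apply, hi, if_true] at this
      exact smul_inj_fs (hv i hi) this
    · rw [hr0 i hi, hr0' i hi]
  · intro l hl
    simp only [hT, Finset.coe_filter, Finset.mem_finsuppAntidiag, Set.mem_setOf_eq] at hl
    obtain ⟨⟨h1, h2⟩, h3⟩ := hl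
    choose! r hr using h3
    refine ⟨fun i => if i ∈ s then r i else 0, ⟨?_, ?_⟩, ?_⟩
    · intro i hi; simp [hi]
    · rw [← h1]
      apply Finset.sum_congr rfl
      intro i hi
      simp [hi, hr i hi]
    · ext1 i
      by_cases hi : i ∈ s
      · simp [hi, hr i hi]
      · have : l i = 0 := by
          by_contra h
          exact hi (h2 (Finsupp.mem_support_iff.2 h))
        simp [hi, this]
  · rintro r ⟨hr0, hr⟩
    apply Finset.prod_congr rfl
    intro i hi
    simp only [Finsupp.onFinset_apply, hi, if_true]
    rw [PSr_coeff_smul _ (hv i hi)]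

noncomputable def mon (i j : ℕ) : ℕ →₀ ℕ := ∑ k ∈ Finset.Ico i j, Finsupp.single k 1

lemma mon_apply (i j k : ℕ) : mon i j k = if i ≤ k ∧ k < j then 1 else 0 := by
  simp [mon, Finsupp.finsetSum_apply, Finsupp.single_apply]

lemma mon_ne_zero {i j : ℕ} (h : i < j) : mon i j ≠ 0 := by
  intro h0
  have := DFunLike.congr_fun h0 i
  simp [mon_apply, h] at this

lemma mon_add {i j k : ℕ} (h : i ≤ j) (h2 : j ≤ k) : mon i j + mon j k = mon i k := by
  unfold mon
  rw [Finset.sum_Ico_consecutive _ h h2]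

noncomputable def ev (i j : ℕ) : ℕ →₀ ℕ := mon (min i j) (max i j)

noncomputable def Gf (i j : ℕ) (r : ℕ) : RatFunc ℚ :=
  if i < j then (if r = 0 then 0 else -((1 - q) * (q⁻¹) ^ r)) else (1 - q) * q ^ r

lemma wt_eq (r : ℕ) : wt r = (if r = 0 then 1 else 0) +
    (((q - 1) ^ 2 / (q ^ 2 - 1)) * q ^ r + (-((q - 1) ^ 2 / (q ^ 2 - 1))) * (q⁻¹) ^ r) := by
  unfold wt
  by_cases h : r = 0
  · simp [h]
  · have := q_ne_zero
    have h2 := q_sub_ne 2 (by omega)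
    simp only [h, if_false, zpow_neg, zpow_natCast, inv_pow]
    field_simp
    ring

lemma Gf_asc (i j : ℕ) (h : i < j) (r : ℕ) : Gf i j r = (1 - q) * (if r = 0 then 1 else 0) +
    (-(1 - q)) * (q⁻¹) ^ r := by
  unfold Gf
  by_cases h : r = 0
  · simp [*]
  · simp only [*, if_true, if_false]; ring

section
variable {K : Type*} [Field K] [Algebra (MvPowerSeries ℕ (RatFunc ℚ)) K]
  [IsFractionRing (MvPowerSeries ℕ (RatFunc ℚ)) K]

local notation "φ" => algebraMap (MvPowerSeries ℕ (RatFunc ℚ)) K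

lemma monomial_eq_C (v : ℕ →₀ ℕ) (a : RatFunc ℚ) : MvPowerSeries.monomial v a =
    MvPowerSeries.C a * MvPowerSeries.monomial v (1 : RatFunc ℚ) := by
  rw [← MvPowerSeries.monomial_zero_eq_C_apply, MvPowerSeries.monomial_mul_monomial]
  simp

lemma phi_geo (a : RatFunc ℚ) {v : ℕ →₀ ℕ} (hv : v ≠ 0) :
    φ (PSr (fun r => a ^ r) v) * (1 - φ (MvPowerSeries.C a) * φ (MvPowerSeries.monomial v 1)) = 1 := by
  rw [← map_mul, ← monomial_eq_C, ← map_one φ, ← map_sub, ← map_mul, PSr_geo _ hv]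

lemma smul_eq_C_mul' (c : RatFunc ℚ) (f : MvPowerSeries ℕ (RatFunc ℚ)) :
    c • f = MvPowerSeries.C c * f := by
  exact MvPowerSeries.smul_eq_C_mul f c

lemma phiC_ne {a : RatFunc ℚ} (ha : a ≠ 0) : φ (MvPowerSeries.C a) ≠ 0 := by
  intro h
  rw [← map_zero φ] at h
  have := IsFractionRing.injective (MvPowerSeries ℕ (RatFunc ℚ)) K h
  have h2 := congrArg MvPowerSeries.constantCoeff this
  simp at h2
  exact ha h2

lemma phi_wt {v : ℕ →₀ ℕ} (hv : v ≠ 0) (c U : K) (hc : c = φ (MvPowerSeries.C q))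
    (hU : U = φ (MvPowerSeries.monomial v 1)) :
    1 - c * U ≠ 0 ∧ 1 - c⁻¹ * U ≠ 0 ∧
    φ (PSr wt v) = (1 - U) ^ 2 / ((1 - c * U) * (1 - c⁻¹ * U)) := by
  have h1 := phi_geo (K := K) q hv
  have h2 := phi_geo (K := K) q⁻¹ hv
  have hc0 : c ≠ 0 := by rw [hc]; exact phiC_ne q_ne_zero
  have hci : φ (MvPowerSeries.C q⁻¹) = c⁻¹ := by
    apply eq_inv_of_mul_eq_one_left
    rw [hc, ← map_mul, ← map_mul, inv_mul_cancel₀ q_ne_zero]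
    simp
  rw [hci] at h2
  rw [← hc] at h1
  rw [← hU] at h1 h2
  have n1 : 1 - c * U ≠ 0 := right_ne_zero_of_mul_eq_one h1
  have n2 : 1 - c⁻¹ * U ≠ 0 := right_ne_zero_of_mul_eq_one h2
  refine ⟨n1, n2, ?_⟩
  have e : PSr wt v = 1 + (((q - 1) ^ 2 / (q ^ 2 - 1)) • PSr (fun r => q ^ r) v +
      (-((q - 1) ^ 2 / (q ^ 2 - 1))) • PSr (fun r => (q⁻¹) ^ r) v) := by
    rw [← PSr_smul, ← PSr_smul, ← PSr_add, ← PSr_delta hv, ← PSr_add]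
    congr 1
    funext r
    exact wt_eq r
  have hq2 : c ^ 2 - 1 ≠ 0 := by
    have := phiC_ne (K := K) (q_sub_ne 2 (by omega))
    simpa [hc] using this
  have hk : φ (MvPowerSeries.C ((q - 1) ^ 2 / (q ^ 2 - 1))) = (c - 1) ^ 2 / (c ^ 2 - 1) := by
    rw [eq_div_iff hq2, hc]
    have : (MvPowerSeries.C ((q - 1) ^ 2 / (q ^ 2 - 1)) : MvPowerSeries ℕ (RatFunc ℚ))
      * (MvPowerSeries.C q ^ 2 - 1) = (MvPowerSeries.C q - 1) ^ 2 := by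
      rw [← map_one (MvPowerSeries.C (σ := ℕ) (R := RatFunc ℚ)), ← map_pow, ← map_sub, ← map_sub,
        ← map_mul, ← map_pow, div_mul_cancel₀ _ (q_sub_ne 2 (by omega))]
    rw [← map_one φ, ← map_pow, ← map_sub, ← map_sub, ← map_mul, this, map_pow]
  rw [e, smul_eq_C_mul', smul_eq_C_mul']
  simp only [map_add, map_mul, map_neg, map_one, hk]
  rw [eq_inv_of_mul_eq_one_left h1, eq_inv_of_mul_eq_one_left h2]
  have n3 : c - U ≠ 0 := by
    intro h
    apply n2
    have : U = c := by linear_combination -h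
    rw [this, inv_mul_cancel₀ hc0, sub_self]
  have e2 : 1 - c⁻¹ * U = (c - U) / c := by field_simp
  rw [e2]
  have n4 : c + 1 ≠ 0 := by
    intro h; apply hq2; linear_combination (c - 1) * h
  have n5 : c - 1 ≠ 0 := by
    intro h; apply hq2; linear_combination (c + 1) * h
  have e3 : c ^ 2 - 1 = (c + 1) * (c - 1) := by ring
  rw [e3]
  field_simp
  ring

lemma phi_Gf_asc {i j : ℕ} (h : i < j) (c U : K) (hc : c = φ (MvPowerSeries.C q))
    (hU : U = φ (MvPowerSeries.monomial (mon i j) 1)) :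
    φ (PSr (Gf i j) (ev i j)) = (1 - c) * U / (U - c) := by
  have hv := mon_ne_zero h
  have h2 := phi_geo (K := K) q⁻¹ hv
  have hc0 : c ≠ 0 := by rw [hc]; exact phiC_ne q_ne_zero
  have hci : φ (MvPowerSeries.C q⁻¹) = c⁻¹ := by
    apply eq_inv_of_mul_eq_one_left
    rw [hc, ← map_mul, ← map_mul, inv_mul_cancel₀ q_ne_zero]
    simp
  rw [hci, ← hU] at h2
  have n2 : 1 - c⁻¹ * U ≠ 0 := right_ne_zero_of_mul_eq_one h2
  have e : PSr (Gf i j) (ev i j) = (1 - q) • 1 + (-(1 - q)) • PSr (fun r => (q⁻¹) ^ r) (mon i j) := by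
    rw [← PSr_delta hv, ← PSr_smul, ← PSr_smul, ← PSr_add]
    rw [ev, min_eq_left h.le, max_eq_right h.le]
    congr 1
    funext r
    exact Gf_asc i j h r
  have n3 : c - U ≠ 0 := by
    intro h
    apply n2
    have : U = c := by linear_combination -h
    rw [this, inv_mul_cancel₀ hc0, sub_self]
  rw [e, smul_eq_C_mul', smul_eq_C_mul']
  simp only [map_add, map_mul, map_neg, map_one, map_sub]
  rw [eq_inv_of_mul_eq_one_left h2, ← hc]
  have e2 : 1 - c⁻¹ * U = (c - U) / c := by field_simp
  have e3 : U - c = - (c - U) := by ring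
  rw [e2, e3]
  field_simp
  ring

lemma phi_Gf_desc {i j : ℕ} (h : j < i) (c U : K) (hc : c = φ (MvPowerSeries.C q))
    (hU : U = φ (MvPowerSeries.monomial (mon j i) 1)) :
    φ (PSr (Gf i j) (ev i j)) = (1 - c) / (1 - c * U) := by
  have hv := mon_ne_zero h
  have h1 := phi_geo (K := K) q hv
  rw [← hc, ← hU] at h1
  have e : PSr (Gf i j) (ev i j) = (1 - q) • PSr (fun r => q ^ r) (mon j i) := by
    rw [← PSr_smul]
    rw [ev, min_eq_right h.le, max_eq_left h.le]
    congr 1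
    funext r
    simp [Gf, h.le]
  rw [e, smul_eq_C_mul']
  simp only [map_mul, map_one, map_sub]
  rw [eq_inv_of_mul_eq_one_left h1, ← hc, div_eq_mul_inv]
end

lemma pairs_prod_fin {M : Type*} [CommMonoid M] (n : ℕ) (f : ℕ × ℕ → M) :
    ∏ p ∈ pairs n, f p = ∏ i : Fin n, ∏ j ∈ Finset.Ioi i, f (i.val + 1, j.val + 1) := by
  rw [Finset.prod_sigma']
  symm
  refine Finset.prod_bij (fun x _ => (x.1.val + 1, x.2.val + 1)) ?_ ?_ ?_ ?_
  · rintro ⟨i, j⟩ h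
    simp at h
    simp [pairs]
    omega
  · rintro ⟨i, j⟩ h ⟨i', j'⟩ h' e
    simp at e
    have e1 : i = i' := Fin.ext e.1
    have e2 : j = j' := Fin.ext e.2
    subst e1; subst e2; rfl
  · rintro ⟨i, j⟩ h
    simp [pairs] at h
    refine ⟨⟨⟨i - 1, by omega⟩, ⟨j - 1, by omega⟩⟩, ?_, ?_⟩
    · simp; omega
    · simp; omega
  · intro x _; rfl

theorem ps_identity (n : ℕ) :
    ∏ p ∈ pairs n, PSr wt (mon p.1 p.2) = ∑ σ : Equiv.Perm (Fin n), ((σ.sign : ℤ) : MvPowerSeries ℕ (RatFunc ℚ)) *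
      ∏ i ∈ σ.support, PSr (Gf (i.val + 1) ((σ i).val + 1)) (ev (i.val + 1) ((σ i).val + 1)) := by
  classical
  set Gm : Matrix (Fin n) (Fin n) (MvPowerSeries ℕ (RatFunc ℚ)) := Matrix.of fun i j =>
    if i = j then 1 else PSr (Gf (i.val + 1) (j.val + 1)) (ev (i.val + 1) (j.val + 1)) with hGm
  have hdet : Gm.det = ∑ σ : Equiv.Perm (Fin n), ((σ.sign : ℤ) : MvPowerSeries ℕ (RatFunc ℚ)) *
      ∏ i ∈ σ.support, PSr (Gf (i.val + 1) ((σ i).val + 1)) (ev (i.val + 1) ((σ i).val + 1)) := by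
    rw [← Matrix.det_transpose, Matrix.det_apply']
    apply Finset.sum_congr rfl
    intro σ _
    congr 1
    rw [← Finset.prod_subset (Finset.subset_univ σ.support)]
    · apply Finset.prod_congr rfl
      intro i hi
      have : i ≠ σ i := fun h => (Equiv.Perm.mem_support.1 hi) h.symm
      simp [hGm, this]
    · intro i _ hi
      have : σ i = i := by simpa using hi
      simp [hGm, this]
  rw [← hdet]
  let K := FractionRing (MvPowerSeries ℕ (RatFunc ℚ))
  let φ := algebraMap (MvPowerSeries ℕ (RatFunc ℚ)) K
  have hinj : Function.Injective φ := IsFractionRing.injective _ K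
  apply hinj
  let c : K := φ (MvPowerSeries.C q)
  have hc0 : c ≠ 0 := phiC_ne q_ne_zero
  let x : Fin n → K := fun i => φ (MvPowerSeries.monomial (mon (i.val + 1) (n + 1)) 1)
  let U : Fin n → Fin n → K := fun i j => φ (MvPowerSeries.monomial (mon (i.val + 1) (j.val + 1)) 1)
  have hxU : ∀ i j, i < j → x i = U i j * x j := by
    intro i j h
    simp only [x, U]
    rw [← map_mul, MvPowerSeries.monomial_mul_monomial, mon_add (by omega) (by omega), one_mul]
  have hx0 : ∀ i, x i ≠ 0 := by
    intro i h
    have h' : φ (MvPowerSeries.monomial (mon (i.val + 1) (n + 1)) 1) = φ 0 := by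
      rw [map_zero]; exact h
    have := hinj h'
    have h2 := congrArg (MvPowerSeries.coeff (mon (i.val + 1) (n + 1))) this
    simp at h2
  have hUw : ∀ i j, i < j → 1 - c * U i j ≠ 0 ∧ 1 - c⁻¹ * U i j ≠ 0 ∧
    φ (PSr wt (mon (i.val + 1) (j.val + 1))) = (1 - U i j) ^ 2 / ((1 - c * U i j) * (1 - c⁻¹ * U i j)) := by
    intro i j h
    exact phi_wt (mon_ne_zero (by simpa using h)) c (U i j) rfl rfl
  have hc1 : 1 - c ≠ 0 := by
    have h1 := q_sub_ne 1 (by omega)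
    have h2 : (1 - q : RatFunc ℚ) ≠ 0 := by
      intro h; apply h1; linear_combination -h
    have := phiC_ne (K := K) h2
    simpa [c, φ] using this
  have hne : ∀ i j, x i - c * x j ≠ 0 := by
    intro i j
    rcases lt_trichotomy i j with h | h | h
    · rw [hxU i j h]
      have h2 := (hUw i j h).2.1
      have : U i j * x j - c * x j = (-c) * (1 - c⁻¹ * U i j) * x j := by
        have : c * c⁻¹ = 1 := mul_inv_cancel₀ hc0
        linear_combination (-U i j * x j) * this
      rw [this]
      exact mul_ne_zero (mul_ne_zero (neg_ne_zero.2 hc0) h2) (hx0 j)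
    · subst h
      have : x i - c * x i = (1 - c) * x i := by ring
      rw [this]
      exact mul_ne_zero hc1 (hx0 i)
    · rw [hxU j i h]
      have : x i - c * (U j i * x i) = (1 - c * U j i) * x i := by ring
      rw [this]
      exact mul_ne_zero (hUw j i h).1 (hx0 i)
  have hC := cauchy_det c hc0 n x hne
  rw [RingHom.map_det]
  have hM : φ.mapMatrix Gm = Matrix.of fun i j => (1 - c) * x i / (x i - c * x j) := by
    ext i j
    simp only [RingHom.mapMatrix_apply, Matrix.map_apply, hGm, Matrix.of_apply]
    have h0 := hne i j
    rcases lt_trichotomy i j with h | h | h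
    · rw [if_neg h.ne, phi_Gf_asc (K := K) (by simpa using h) c (U i j) rfl rfl]
      rw [hxU i j h] at h0 ⊢
      have e : U i j * x j - c * x j = (U i j - c) * x j := by ring
      rw [e] at h0 ⊢
      rw [← mul_assoc, mul_div_mul_right _ _ (hx0 j)]
    · subst h
      have e : x i - c * x i = (1 - c) * x i := by ring
      rw [e] at h0 ⊢
      simp [div_self h0]
    · rw [if_neg h.ne', phi_Gf_desc (K := K) (by simpa using h) c (U j i) rfl rfl]
      rw [hxU j i h] at h0 ⊢
      have e : x i - c * (U j i * x i) = (1 - c * U j i) * x i := by ring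
      rw [e, mul_div_mul_right _ _ (hx0 i)]
  rw [hM, hC, map_prod, pairs_prod_fin]
  apply Finset.prod_congr rfl
  intro i _
  apply Finset.prod_congr rfl
  intro j hj
  have h : i < j := by simpa using hj
  rw [(hUw i j h).2.2, hxU i j h]
  have e1 : x j - U i j * x j = (1 - U i j) * x j := by ring
  have e2 : x j - c * (U i j * x j) = (1 - c * U i j) * x j := by ring
  have e3 : x j - c⁻¹ * (U i j * x j) = (1 - c⁻¹ * U i j) * x j := by ring
  rw [e1, e2, e3]
  have := hx0 j
  have e4 : (1 - c * U i j) * x j * ((1 - c⁻¹ * U i j) * x j) =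
    ((1 - c * U i j) * (1 - c⁻¹ * U i j)) * (x j) ^ 2 := by ring
  rw [e4, mul_pow, mul_div_mul_right _ _ (pow_ne_zero 2 this)]

lemma geo_sum (Q : RatFunc ℚ) (hQ : Q ≠ 0) (A B : ℤ) (h : A ≤ B) :
    (Q - 1) * ∑ t ∈ Finset.Ico A B, Q ^ t = Q ^ B - Q ^ A := by
  induction B, h using Int.leInduction with
  | base => simp
  | succ B hB ih =>
    have : Finset.Ico A (B + 1) = insert B (Finset.Ico A B) := by
      ext t; simp; omega
    rw [this, Finset.sum_insert (by simp), mul_add, ih, zpow_add_one₀ hQ]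
    ring

open Classical in
lemma geo_valid {ι : Type*} [Fintype ι] (asc : ι → Prop) (P : ι → ℤ) (Q : RatFunc ℚ) (hQ : Q ≠ 0)
    (A B : ℤ) (kA kB : ι) (hkA : ¬ asc kA) (hkB : asc kB) (hA : P kA = A) (hB : P kB = B)
    (hA' : ∀ k, ¬ asc k → P k ≤ A) (hB' : ∀ k, asc k → B ≤ P k)
    (huniq : ∀ k, (∀ j, (asc j → P k ≤ P j) ∧ (¬ asc j → P j ≤ P k)) → ∀ j, P j = P k → j = k) :
    (Q - 1) * ∑ t ∈ Finset.Ico A B, Q ^ t =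
      ∑ k, if (∀ j, (asc j → P k ≤ P j) ∧ (¬ asc j → P j ≤ P k)) then
        (if asc k then 1 else -1) * Q ^ (P k) else 0 := by
  by_cases h : A ≤ B
  · rw [geo_sum Q hQ A B h]
    have hne : kA ≠ kB := fun h => hkA (h ▸ hkB)
    have vA : ∀ j, (asc j → P kA ≤ P j) ∧ (¬ asc j → P j ≤ P kA) := by
      intro j
      exact ⟨fun hj => by have := hB' j hj; omega, fun hj => by have := hA' j hj; omega⟩
    have vB : ∀ j, (asc j → P kB ≤ P j) ∧ (¬ asc j → P j ≤ P kB) := by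
      intro j
      exact ⟨fun hj => by have := hB' j hj; omega, fun hj => by have := hA' j hj; omega⟩
    rw [← Finset.sum_subset (Finset.subset_univ {kA, kB})]
    · rw [Finset.sum_pair hne, if_pos vA, if_pos vB, if_neg hkA, if_pos hkB, hA, hB]
      ring
    · intro k _ hk
      rw [if_neg]
      intro v
      apply hk
      by_cases hak : asc k
      · have h1 := (v kB).1 hkB
        have h2 := hB' k hak
        have := huniq k v kB (by omega)
        simp [this]
      · have h1 := (v kA).2 hkA
        have h2 := hA' k hak
        have := huniq k v kA (by omega)
        simp [this]
  · rw [Finset.Ico_eq_empty (by omega)]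
    rw [Finset.sum_empty, mul_zero]
    symm
    apply Finset.sum_eq_zero
    · intro k _
      rw [if_neg]
      intro v
      have h1 := (v kB).1 hkB
      have h2 := (v kA).2 hkA
      omega

def sgnok {n : ℕ} (σ : Equiv.Perm (Fin n)) (M : Fin n → ℤ) : Prop :=
  ∀ i, (i < σ i → 0 ≤ M i) ∧ (σ i < i → M i ≤ 0)

lemma shift_cycle {n : ℕ} (σ : Equiv.Perm (Fin n)) (L M : Fin n → ℤ) (hs : sgnok σ M)
    (hr : ∀ i, L (σ i) = M (σ i) - M i) (x : Fin n) :
    ∃ M' : Fin n → ℤ, sgnok σ M' ∧ (∀ i, L (σ i) = M' (σ i) - M' i) ∧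
      (∀ j, ¬ σ.SameCycle x j → M' j = M j) ∧ ∃ i, σ.SameCycle x i ∧ (M' i = 0 ∨ σ i = i) := by
  classical
  by_cases hx : σ x = x
  · exact ⟨M, hs, hr, fun _ _ => rfl, x, Equiv.Perm.SameCycle.refl _ _, Or.inr hx⟩
  · let O := Finset.univ.filter (fun i => σ.SameCycle x i)
    have hO : O.Nonempty := ⟨x, by simp [O, Equiv.Perm.SameCycle.refl]⟩
    obtain ⟨i1, hi1, hmin1⟩ := O.exists_min_image id hO
    have hi1' : σ.SameCycle x i1 := by simpa [O] using hi1
    have hne : σ i1 ≠ i1 := by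
      intro h
      have := hi1'.symm.apply_eq_self_iff.1 h
      exact hx this
    have hasc : i1 < σ i1 := by
      have := hmin1 (σ i1) (by simp [O, hi1'])
      exact lt_of_le_of_ne this (Ne.symm hne)
    let OA := O.filter (fun i => i < σ i)
    obtain ⟨i0, hi0, hmin0⟩ := OA.exists_min_image M ⟨i1, by simp [OA, hi1, hasc]⟩
    have hi0' : σ.SameCycle x i0 ∧ i0 < σ i0 := by simpa [OA, O] using hi0
    refine ⟨fun i => if σ.SameCycle x i then M i - M i0 else M i, ?_, ?_, ?_, i0, hi0'.1, ?_⟩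
    · intro i
      have h0 := (hs i0).1 hi0'.2
      dsimp only
      split_ifs with h
      · constructor
        · intro hi
          have := hmin0 i (by simp [OA, O, h, hi])
          omega
        · intro hi
          have := (hs i).2 hi
          omega
      · exact hs i
    · intro i
      simp only [Equiv.Perm.sameCycle_apply_right]
      rw [hr i]
      split_ifs <;> ring
    · intro j hj
      simp [hj]
    · simp [hi0'.1]

def Ms {n : ℕ} (σ : Equiv.Perm (Fin n)) (r : Fin n → ℕ) (i : Fin n) : ℤ :=
  if i < σ i then (r i : ℤ) else -(r i : ℤ)

def Kset {n : ℕ} (L : Fin n → ℤ) (σ : Equiv.Perm (Fin n)) : Set (Fin n → ℕ) :=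
  {r | (∀ i ∉ σ.support, r i = 0) ∧ ∀ i, L (σ i) = Ms σ r (σ i) - Ms σ r i}

noncomputable def Kf {n : ℕ} (L : Fin n → ℤ) (σ : Equiv.Perm (Fin n)) : RatFunc ℚ :=
  ∑ᶠ r ∈ Kset L σ, ∏ i ∈ σ.support, Gf (i.val + 1) ((σ i).val + 1) (r i)

def NotSing {n : ℕ} (L : Fin n → ℤ) : Prop :=
  ∀ (σ : Equiv.Perm (Fin n)) (M : Fin n → ℤ), sgnok σ M → (∀ i, L (σ i) = M (σ i) - M i) →
    ∀ i j, i ≠ j → (M i = 0 ∨ σ i = i) → (M j = 0 ∨ σ j = j) → False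

lemma Ms_sgnok {n : ℕ} (σ : Equiv.Perm (Fin n)) (r : Fin n → ℕ) : sgnok σ (Ms σ r) := by
  intro i
  constructor
  · intro h; simp [Ms, h]
  · intro h; simp [Ms, h.not_gt]

lemma Kf_notfull {n : ℕ} (L : Fin n → ℤ) (hL : NotSing L) (σ : Equiv.Perm (Fin n))
    (x y : Fin n) (hxy : ¬ σ.SameCycle x y) : Kf L σ = 0 := by
  have : Kset L σ = ∅ := by
    ext r
    simp only [Set.mem_empty_iff_false, iff_false]
    rintro ⟨_, hr⟩
    obtain ⟨M1, hs1, hr1, -, i, hi, hi0⟩ := shift_cycle σ L _ (Ms_sgnok σ r) hr x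
    obtain ⟨M2, hs2, hr2, he, j, hj, hj0⟩ := shift_cycle σ L _ hs1 hr1 y
    have hyi : ¬ σ.SameCycle y i := fun h => hxy (hi.trans h.symm)
    refine hL σ M2 hs2 hr2 i j ?_ ?_ hj0
    · rintro rfl
      exact hyi hj
    · rwa [he i hyi]
  rw [Kf, this]
  simp

lemma fin_const {m : ℕ} (h : Fin (m + 2) → ℤ) (hh : ∀ k, h (k + 1) = h k) (k : Fin (m + 2)) :
    h k = h (Fin.last (m + 1)) := by
  have h0 : h (Fin.last (m + 1)) = h 0 := by
    rw [← hh (Fin.last (m + 1)), Fin.last_add_one]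
  rw [h0]
  induction k using Fin.induction with
  | zero => rfl
  | succ i ih => rw [← Fin.coeSucc_eq_succ, hh, ih]

open Classical in
lemma Kf_cycle {m : ℕ} (L : Fin (m + 2) → ℤ) (hL : NotSing L) (w σ : Equiv.Perm (Fin (m + 2)))
    (hσ : ∀ k, σ (w k) = w (k + 1)) (P : Fin (m + 2) → ℤ)
    (hP : ∀ k, P (k + 1) = P k + L (w (k + 1))) :
    (q ^ (m + 2) - 1) * Kf L σ =
      (1 - q) ^ (m + 2) * (∏ k, if w k < w (k + 1) then (-1 : RatFunc ℚ) else 1) * q ^ (-∑ k, P k) *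
      ∑ k, if (∀ j, (w j < w (j + 1) → P k ≤ P j) ∧ (¬ w j < w (j + 1) → P j ≤ P k)) then
        (if w k < w (k + 1) then 1 else -1) * (q ^ (m + 2)) ^ (P k) else 0 := by
  have hne : ∀ k, w (k + 1) ≠ w k := by
    intro k h
    have := w.injective h
    simp at this
  have hsupp : σ.support = Finset.univ := by
    ext i
    simp only [Equiv.Perm.mem_support, Finset.mem_univ, iff_true]
    obtain ⟨k, rfl⟩ := w.surjective i
    rw [hσ]
    exact hne k
  -- extremal indices
  have hexA : ∃ k, ¬ w k < w (k + 1) := by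
    refine ⟨w.symm (Fin.last _), ?_⟩
    simp [Fin.le_last]
  have hexB : ∃ k, w k < w (k + 1) := by
    refine ⟨w.symm 0, ?_⟩
    have := hne (w.symm 0)
    rw [Equiv.apply_symm_apply] at this ⊢
    exact Fin.pos_iff_ne_zero.2 this
  obtain ⟨kA, hkA, hAmax⟩ := (Finset.univ.filter fun k => ¬ w k < w (k + 1)).exists_max_image P
    (by obtain ⟨k, hk⟩ := hexA; exact ⟨k, by simpa using hk⟩)
  obtain ⟨kB, hkB, hBmin⟩ := (Finset.univ.filter fun k => w k < w (k + 1)).exists_min_image P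
    (by obtain ⟨k, hk⟩ := hexB; exact ⟨k, by simpa using hk⟩)
  have hkA' : ¬ w kA < w (kA + 1) := (Finset.mem_filter.1 hkA).2
  have hkB' : w kB < w (kB + 1) := (Finset.mem_filter.1 hkB).2
  have hA' : ∀ k, ¬ w k < w (k + 1) → P k ≤ P kA := fun k hk => hAmax k (by simpa using hk)
  have hB' : ∀ k, w k < w (k + 1) → P kB ≤ P k := fun k hk => hBmin k (by simpa using hk)
  have huniq : ∀ k, (∀ j, (w j < w (j + 1) → P k ≤ P j) ∧ (¬ w j < w (j + 1) → P j ≤ P k)) →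
      ∀ j, P j = P k → j = k := by
    intro k v j hj
    by_contra hjk
    refine hL σ (fun i => P (w.symm i) - P k) ?_ ?_ (w j) (w k) (by simpa using hjk)
      (Or.inl (by simp [hj])) (Or.inl (by simp))
    · intro i
      obtain ⟨l, rfl⟩ := w.surjective i
      rw [hσ]
      simp only [Equiv.symm_apply_apply]
      exact ⟨fun h => by have := (v l).1 h; omega, fun h => by have := (v l).2 h.not_gt; omega⟩
    · intro i
      obtain ⟨l, rfl⟩ := w.surjective i
      rw [hσ]
      simp only [Equiv.symm_apply_apply]
      rw [hP]; ring
  have hgeo := geo_valid (fun k => w k < w (k + 1)) P (q ^ (m + 2)) (pow_ne_zero _ q_ne_zero) (P kA) (P kB)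
    kA kB hkA' hkB' rfl rfl hA' hB' huniq
  have hgeo' : (q ^ (m + 2) - 1) * ∑ t ∈ Finset.Ico (P kA) (P kB), (q ^ (m + 2)) ^ t =
      ∑ k, if (∀ j, (w j < w (j + 1) → P k ≤ P j) ∧ (¬ w j < w (j + 1) → P j ≤ P k)) then
        (if w k < w (k + 1) then 1 else -1) * (q ^ (m + 2)) ^ (P k) else 0 := by
    rw [hgeo]
    apply Finset.sum_congr rfl
    intro k _
    congr
  rw [← hgeo']
  -- the finsum
  have hK : Kf L σ = ∑ᶠ t ∈ ((Finset.Icc (P kA) (P kB) : Finset ℤ) : Set ℤ),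
      ∏ k, Gf ((w k).val + 1) ((w (k + 1)).val + 1) (P k - t).natAbs := by
    rw [Kf]
    symm
    refine finsum_mem_eq_of_bijOn (fun t i => (P (w.symm i) - t).natAbs) ⟨?_, ?_, ?_⟩ ?_
    · intro t ht
      have ht' : P kA ≤ t ∧ t ≤ P kB := by simpa using ht
      have key : ∀ l, Ms σ (fun i => (P (w.symm i) - t).natAbs) (w l) = P l - t := by
        intro l
        simp only [Ms, hσ, Equiv.symm_apply_apply]
        split_ifs with h
        · have := hB' l h; omega
        · have := hA' l h; omega
      refine ⟨?_, ?_⟩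
      · intro i hi
        simp [hsupp] at hi
      · intro i
        obtain ⟨l, rfl⟩ := w.surjective i
        rw [hσ, key, key, hP]; ring
    · intro t ht t' ht' h
      have h1 : P kA ≤ t ∧ t ≤ P kB := by simpa using ht
      have h2 : P kA ≤ t' ∧ t' ≤ P kB := by simpa using ht'
      have := congrFun h (w kA)
      simp only [Equiv.symm_apply_apply] at this
      omega
    · rintro r ⟨-, hr⟩
      have hc := fin_const (fun k => P k - Ms σ r (w k)) (by
        intro k
        have := hr (w k)
        rw [hσ] at this
        have h2 := hP k
        omega)
      set t := P (Fin.last (m + 1)) - Ms σ r (w (Fin.last (m + 1))) with ht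
      have hk : ∀ k, (w k < w (k + 1) → P k - t = r (w k)) ∧ (¬ w k < w (k + 1) → P k - t = - r (w k)) := by
        intro k
        have := hc k
        simp only [Ms, hσ] at this
        constructor
        · intro h; rw [if_pos h] at this; omega
        · intro h; rw [if_neg h] at this; omega
      refine ⟨t, ?_, ?_⟩
      · simp only [Finset.coe_Icc, Set.mem_Icc]
        have h1 := (hk kA).2 hkA'
        have h2 := (hk kB).1 hkB'
        omega
      · funext i
        obtain ⟨l, rfl⟩ := w.surjective i
        simp only [Equiv.symm_apply_apply]
        by_cases h : w l < w (l + 1)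
        · have := (hk l).1 h; omega
        · have := (hk l).2 h; omega
    · intro t ht
      rw [hsupp, ← Equiv.prod_comp w (fun i => Gf (i.val + 1) ((σ i).val + 1) (P (w.symm i) - t).natAbs)]
      simp [hσ]
  rw [hK, finsum_mem_coe_finset, ← Finset.sum_subset (s₁ := Finset.Ico (P kA) (P kB))
    Finset.Ico_subset_Icc_self]
  · have : ∀ t ∈ Finset.Ico (P kA) (P kB), ∏ k, Gf ((w k).val + 1) ((w (k + 1)).val + 1) (P k - t).natAbs
      = (1 - q) ^ (m + 2) * (∏ k, if w k < w (k + 1) then (-1 : RatFunc ℚ) else 1) * q ^ (-∑ k, P k) *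
        (q ^ (m + 2)) ^ t := by
      intro t ht
      simp only [Finset.mem_Ico] at ht
      have e : ∀ k, Gf ((w k).val + 1) ((w (k + 1)).val + 1) (P k - t).natAbs =
          (1 - q) * (if w k < w (k + 1) then (-1 : RatFunc ℚ) else 1) * (q ^ (-P k) * q ^ t) := by
        intro k
        rw [← zpow_add₀ q_ne_zero]
        unfold Gf
        by_cases h : w k < w (k + 1)
        · have h1 := hB' k h
          have h2 : (w k).val + 1 < (w (k + 1)).val + 1 := by simpa using h
          rw [if_pos h2, if_pos h, if_neg (by omega), inv_pow, ← zpow_natCast, ← zpow_neg]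
          have : -((P k - t).natAbs : ℤ) = -P k + t := by omega
          rw [this]; ring
        · have h1 := hA' k h
          have h2 : ¬ (w k).val + 1 < (w (k + 1)).val + 1 := by simpa using h
          rw [if_neg h2, if_neg h, ← zpow_natCast]
          have : ((P k - t).natAbs : ℤ) = -P k + t := by omega
          rw [this]; ring
      rw [Finset.prod_congr rfl (fun k _ => e k), Finset.prod_mul_distrib, Finset.prod_mul_distrib,
        Finset.prod_mul_distrib]
      simp only [Finset.prod_const, Finset.card_univ, Fintype.card_fin]
      have e2 : ∏ k, q ^ (-P k) = q ^ (-∑ k, P k) := by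
        rw [← Finset.sum_neg_distrib]
        induction (Finset.univ : Finset (Fin (m + 2))) using Finset.induction_on with
        | empty => simp
        | insert a s ha ih => rw [Finset.prod_insert ha, Finset.sum_insert ha, zpow_add₀ q_ne_zero, ih]
      rw [e2, ← zpow_natCast (q ^ t), ← zpow_natCast q (m + 2), ← zpow_mul, ← zpow_mul, mul_comm t]
      ring
    rw [Finset.sum_congr rfl this, ← Finset.mul_sum]
    ring
  · intro t ht ht2
    have h1 : t = P kB := by
      simp only [Finset.mem_Icc, Finset.mem_Ico] at ht ht2; omega
    apply Finset.prod_eq_zero (Finset.mem_univ kB)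
    have h2 : (w kB).val + 1 < (w (kB + 1)).val + 1 := by simpa using hkB'
    simp [Gf, h1]
    intro h
    exact absurd hkB' (not_lt.2 h)

def rotP {m : ℕ} (w : Equiv.Perm (Fin (m + 2))) : Equiv.Perm (Fin (m + 2)) :=
  w * finRotate (m + 2) * w⁻¹

lemma rotP_apply {m : ℕ} (w : Equiv.Perm (Fin (m + 2))) (k : Fin (m + 2)) :
    rotP w (w k) = w (k + 1) := by
  simp [rotP]

lemma rot_same {m : ℕ} (x y : Fin (m + 2)) : (finRotate (m + 2)).SameCycle x y := by
  have h1 := isCycle_finRotate (n := m)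
  exact h1.sameCycle (by simp) (by simp)

open Classical in
lemma sum_full {m : ℕ} (Fn : Equiv.Perm (Fin (m + 2)) → RatFunc ℚ) :
    ∑ w : Equiv.Perm (Fin (m + 2)), Fn (rotP w) =
      ((m + 2 : ℕ) : RatFunc ℚ) * ∑ σ ∈ Finset.univ.filter (fun σ : Equiv.Perm (Fin (m + 2)) =>
        ∀ x y, σ.SameCycle x y), Fn σ := by
  have : ((m + 2 : ℕ) : RatFunc ℚ) * ∑ σ ∈ Finset.univ.filter (fun σ : Equiv.Perm (Fin (m + 2)) =>
        ∀ x y, σ.SameCycle x y), Fn σ = ∑ p ∈ (Finset.univ.filter (fun σ : Equiv.Perm (Fin (m + 2)) =>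
        ∀ x y, σ.SameCycle x y)) ×ˢ (Finset.univ : Finset (Fin (m + 2))), Fn p.1 := by
    rw [Finset.sum_product]
    simp [Finset.mul_sum]
  rw [this]
  refine Finset.sum_bij (fun w _ => (rotP w, w 0)) ?_ ?_ ?_ ?_
  · intro w _
    simp only [Finset.mem_product, Finset.mem_filter, Finset.mem_univ, true_and, and_true]
    intro x y
    rw [rotP, Equiv.Perm.sameCycle_conj]
    exact rot_same _ _
  · intro w _ w' _ h
    simp only [Prod.mk.injEq] at h
    obtain ⟨h1, h2⟩ := h
    ext1 k
    induction k using Fin.induction with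
    | zero => exact h2
    | succ i ih =>
      rw [← Fin.coeSucc_eq_succ, ← rotP_apply, ← rotP_apply, h1, ih]
  · rintro ⟨σ, x⟩ h
    simp only [Finset.mem_product, Finset.mem_filter, Finset.mem_univ, true_and, and_true] at h
    have hne : ∀ y, σ y ≠ y := by
      intro y hy
      obtain ⟨z, hz⟩ := exists_ne y
      have := (h y z).symm
      obtain ⟨i, hi⟩ := h y z
      rw [Equiv.Perm.zpow_apply_eq_self_of_apply_eq_self hy] at hi
      exact hz hi.symm
    have hc : σ.IsCycle := ⟨x, hne x, fun y _ => h x y⟩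
    have hsupp : σ.support = Finset.univ := by
      ext y; simp [hne y]
    have hconj : IsConj (finRotate (m + 2)) σ := by
      rw [isCycle_finRotate.isConj_iff hc, hsupp, support_finRotate]
    obtain ⟨w0, hw0⟩ := isConj_iff.1 hconj
    refine ⟨w0 * (Equiv.addRight (w0⁻¹ x)), Finset.mem_univ _, ?_⟩
    ext1
    · ext1 y
      obtain ⟨z, rfl⟩ := (w0 * (Equiv.addRight (w0⁻¹ x))).surjective y
      rw [rotP_apply, ← hw0]
      simp
      abel_nf
    · simp
  · intro w _; rfl

open Classical in
noncomputable def gterm {m : ℕ} (P : Equiv.Perm (Fin (m + 2)) → Fin (m + 2) → ℤ)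
    (w : Equiv.Perm (Fin (m + 2))) : RatFunc ℚ :=
  if (∀ j, (w j < w (j + 1) → 0 ≤ P w j) ∧ (¬ w j < w (j + 1) → P w j ≤ 0)) then
    (∏ k ∈ Finset.univ.erase (Fin.last (m + 1)), if w k < w (k + 1) then (-1 : RatFunc ℚ) else 1) *
      q ^ (-∑ k, P w k) else 0

theorem core {m : ℕ} (L : Fin (m + 2) → ℤ) (hL : NotSing L)
    (P : Equiv.Perm (Fin (m + 2)) → Fin (m + 2) → ℤ)
    (hP : ∀ w k, P w (k + 1) = P w k + L (w (k + 1))) (hlast : ∀ w, P w (Fin.last (m + 1)) = 0) :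
    ∑ σ : Equiv.Perm (Fin (m + 2)), ((σ.sign : ℤ) : RatFunc ℚ) * Kf L σ =
      (q - 1) ^ (m + 2) / (q ^ (m + 2) - 1) * ∑ w, gterm P w := by
  classical
  have hrot : ∀ w (k j : Fin (m + 2)), P (w * Equiv.addRight (k + 1)) j = P w (j + (k + 1)) - P w k := by
    intro w k j
    have := fin_const (fun j => P w (j + (k + 1)) - P (w * Equiv.addRight (k + 1)) j) (by
      intro j
      have h1 := hP (w * Equiv.addRight (k + 1)) j
      have h2 := hP w (j + (k + 1))
      have e : j + (k + 1) + 1 = j + 1 + (k + 1) := by abel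
      rw [e] at h2
      simp only [Equiv.Perm.mul_apply, Equiv.coe_addRight] at h1
      omega) j
    have e : Fin.last (m + 1) + (k + 1) = k := by
      rw [add_comm k 1, ← add_assoc, Fin.last_add_one, zero_add]
    simp only [hlast, e] at this
    omega
  have hterm : ∀ w, (q ^ (m + 2) - 1) * Kf L (rotP w) =
      -(1 - q) ^ (m + 2) * ∑ k, gterm P (w * Equiv.addRight (k + 1)) := by
    intro w
    rw [Kf_cycle L hL w (rotP w) (rotP_apply w) (P w) (hP w), Finset.mul_sum, Finset.mul_sum]
    apply Finset.sum_congr rfl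
    intro k _
    have hvalid : (∀ j, ((w * Equiv.addRight (k + 1)) j < (w * Equiv.addRight (k + 1)) (j + 1) →
        0 ≤ P (w * Equiv.addRight (k + 1)) j) ∧
        (¬ (w * Equiv.addRight (k + 1)) j < (w * Equiv.addRight (k + 1)) (j + 1) →
          P (w * Equiv.addRight (k + 1)) j ≤ 0)) ↔
        (∀ j, (w j < w (j + 1) → P w k ≤ P w j) ∧ (¬ w j < w (j + 1) → P w j ≤ P w k)) := by
      rw [← (Equiv.addRight (k + 1)).forall_congr_right (q := fun j => (w j < w (j + 1) → P w k ≤ P w j) ∧ (¬ w j < w (j + 1) → P w j ≤ P w k))]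
      apply forall_congr'
      intro j
      have e : j + (k + 1) + 1 = j + 1 + (k + 1) := by abel
      simp only [Equiv.Perm.mul_apply, Equiv.coe_addRight, hrot, e, sub_nonneg, sub_nonpos]
    unfold gterm
    by_cases hv : (∀ j, (w j < w (j + 1) → P w k ≤ P w j) ∧ (¬ w j < w (j + 1) → P w j ≤ P w k))
    · rw [if_pos hv, if_pos (hvalid.2 hv)]
      have e1 : ∑ j, P (w * Equiv.addRight (k + 1)) j = ∑ j, P w j - (m + 2 : ℕ) * P w k := by
        simp only [hrot]
        have := Equiv.sum_comp (Equiv.addRight (k + 1)) (P w)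
        simp only [Equiv.coe_addRight] at this
        rw [Finset.sum_sub_distrib, this]
        simp
      have e2 : (∏ j ∈ Finset.univ.erase (Fin.last (m + 1)),
          if (w * Equiv.addRight (k + 1)) j < (w * Equiv.addRight (k + 1)) (j + 1)
            then (-1 : RatFunc ℚ) else 1) =
          ∏ j ∈ Finset.univ.erase k, if w j < w (j + 1) then (-1 : RatFunc ℚ) else 1 := by
        refine Finset.prod_bij (fun j _ => j + (k + 1)) ?_ ?_ ?_ ?_
        · intro j hj
          simp only [Finset.mem_erase, Finset.mem_univ, and_true] at hj ⊢
          intro h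
          apply hj
          have : j + 1 = 0 := by
            have : j + 1 + k = 0 + k := by
              rw [zero_add]
              refine Eq.trans ?_ h
              abel
            exact add_right_cancel this
          have h3 : j + 1 = Fin.last (m + 1) + 1 := by rw [this, Fin.last_add_one]
          exact add_right_cancel h3
        · intro a _ b _ h
          exact add_right_cancel h
        · intro b hb
          refine ⟨b - (k + 1), ?_, by simp⟩
          simp only [Finset.mem_erase, Finset.mem_univ, and_true] at hb ⊢
          intro h
          apply hb
          rw [sub_eq_iff_eq_add] at h
          rw [h, add_comm k 1, ← add_assoc, Fin.last_add_one, zero_add]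
        · intro j _
          have e : j + (k + 1) + 1 = j + 1 + (k + 1) := by abel
          simp only [Equiv.Perm.mul_apply, Equiv.coe_addRight, e]
          rfl
      rw [e1, e2, ← Finset.mul_prod_erase Finset.univ _ (Finset.mem_univ k)]
      have e3 : q ^ (-(∑ j, P w j - (m + 2 : ℕ) * P w k)) = q ^ (-∑ j, P w j) * (q ^ (m + 2)) ^ (P w k) := by
        rw [← zpow_natCast q (m + 2), ← zpow_mul, ← zpow_add₀ q_ne_zero]
        congr 1
        ring
      rw [e3]
      by_cases ha : w k < w (k + 1)
      · simp only [ha, if_true]; ring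
      · simp only [ha, if_false]; ring
    · rw [if_neg hv, if_neg (fun h => hv (hvalid.1 h))]
      simp
  have hq := q_sub_ne (m + 2) (by omega)
  have hn : ((m + 2 : ℕ) : RatFunc ℚ) ≠ 0 := by exact_mod_cast (by omega : m + 2 ≠ 0)
  rw [div_mul_eq_mul_div, eq_div_iff hq]
  apply mul_left_cancel₀ hn
  have hsum : ∑ σ : Equiv.Perm (Fin (m + 2)), ((σ.sign : ℤ) : RatFunc ℚ) * Kf L σ =
      ∑ σ ∈ Finset.univ.filter (fun σ : Equiv.Perm (Fin (m + 2)) =>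
        ∀ x y, σ.SameCycle x y), ((σ.sign : ℤ) : RatFunc ℚ) * Kf L σ := by
    symm
    apply Finset.sum_subset (Finset.filter_subset _ _)
    intro σ _ hσ
    have : ¬ ∀ x y, σ.SameCycle x y := by simpa using hσ
    push Not at this
    obtain ⟨x, y, hxy⟩ := this
    rw [Kf_notfull L hL σ x y hxy, mul_zero]
  rw [hsum, ← mul_assoc, ← sum_full (fun σ => ((σ.sign : ℤ) : RatFunc ℚ) * Kf L σ)]
  have hsg : ∀ w : Equiv.Perm (Fin (m + 2)), (((rotP w).sign : ℤ) : RatFunc ℚ) = (-1) ^ (m + 1) := by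
    intro w
    have : (rotP w).sign = (-1) ^ (m + 1) := by
      rw [rotP, map_mul, map_mul, mul_comm, ← mul_assoc, ← map_mul, inv_mul_cancel, map_one, one_mul,
        sign_finRotate]
      rfl
    rw [this]; simp
  simp only [hsg]
  rw [← Finset.mul_sum, mul_assoc, Finset.sum_mul]
  have : ∀ w, Kf L (rotP w) * (q ^ (m + 2) - 1) =
      -(1 - q) ^ (m + 2) * ∑ k, gterm P (w * Equiv.addRight (k + 1)) := by
    intro w; rw [mul_comm, hterm]
  simp only [this]
  rw [← Finset.mul_sum, Finset.sum_comm]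
  have h3 : ∀ k : Fin (m + 2), ∑ w, gterm P (w * Equiv.addRight (k + 1)) = ∑ w, gterm P w := by
    intro k
    exact Equiv.sum_comp (Equiv.mulRight (Equiv.addRight (k + 1))) (gterm P)
  simp only [h3]
  have h4 : (1 - q : RatFunc ℚ) ^ (m + 2) = (-1) ^ (m + 2) * (q - 1) ^ (m + 2) := by
    rw [← mul_pow]; congr 1; ring
  rw [h4]
  have h5 : ((-1 : RatFunc ℚ) ^ (m + 1)) * (-((-1) ^ (m + 2))) = 1 := by
    rw [pow_succ _ (m + 1)]
    have : ((-1 : RatFunc ℚ) ^ (m + 1)) * (-1) ^ (m + 1) = 1 := by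
      rw [← mul_pow]; simp
    linear_combination this
  simp only [Finset.sum_const, Finset.card_univ, Fintype.card_fin, nsmul_eq_mul]
  linear_combination ((q - 1) ^ (m + 2) * (((m + 2 : ℕ) : RatFunc ℚ) * ∑ w, gterm P w)) * h5

lemma sing_of_sum {ι : Type*} (n : ℕ) (I : Finset ι) (c : ι → ℝ) (u : ι → ℕ → ℝ)
    (hc : ∀ i ∈ I, 0 ≤ c i) (hu : ∀ i ∈ I, u i ∈ posRoots n) (hI : I.card ≤ n - 2) :
    IsSingular n (∑ i ∈ I, c i • u i) := by
  classical
  refine ⟨I.image u, ?_, Finset.card_image_le.trans hI, fun x => ∑ i ∈ I with u i = x, c i, ?_, ?_⟩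
  · intro x hx
    simp only [Finset.coe_image, Set.mem_image, Finset.mem_coe] at hx
    obtain ⟨i, hi, rfl⟩ := hx
    exact hu i hi
  · intro x _
    apply Finset.sum_nonneg
    intro i hi
    exact hc i (Finset.mem_filter.1 hi).1
  · rw [← Finset.sum_fiberwise_of_maps_to (fun i hi => Finset.mem_image_of_mem u hi)]
    apply Finset.sum_congr rfl
    intro x _
    rw [Finset.sum_smul]
    apply Finset.sum_congr rfl
    intro i hi
    rw [(Finset.mem_filter.1 hi).2]

lemma cyc_sum {n : ℕ} (σ : Equiv.Perm (Fin n)) (M : Fin n → ℤ) (y : Fin n) :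
    ∑ k, M k * ((if y.val + 1 = k.val + 1 then 1 else 0) - (if y.val + 1 = (σ k).val + 1 then 1 else 0)) =
      M y - M (σ.symm y) := by
  have e1 : ∀ k : Fin n, (y.val + 1 = k.val + 1) ↔ k = y := by intro k; rw [Fin.ext_iff]; omega
  have e2 : ∀ k : Fin n, (σ k = y) ↔ k = σ.symm y := by
    intro k; rw [Equiv.eq_symm_apply]
  simp only [e1, e2, mul_sub, mul_ite, mul_one, mul_zero, Finset.sum_sub_distrib]
  simp

lemma notSing_of_regular (n : ℕ) (lam : ℕ → ℤ) (h0 : ∀ k ∉ Finset.Icc 1 n, lam k = 0)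
    (hreg : ¬ IsSingular n (fun k => (lam k : ℝ))) :
    NotSing (fun i : Fin n => lam (i.val + 1)) := by
  classical
  intro σ M hs hM i j hij hi hj
  apply hreg
  have key : (fun k => (lam k : ℝ)) = ∑ k ∈ (((Finset.univ.erase i).erase j).filter fun k => σ k ≠ k),
      (|M k| : ℝ) • rootR (min (k.val + 1) ((σ k).val + 1)) (max (k.val + 1) ((σ k).val + 1)) := by
    have h1 : ∀ k : Fin n, σ k ≠ k → ∀ x : ℕ, ((|M k| : ℝ) • rootR (min (k.val + 1) ((σ k).val + 1)) (max (k.val + 1) ((σ k).val + 1))) x =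
        ((M k * ((if x = k.val + 1 then 1 else 0) - (if x = (σ k).val + 1 then 1 else 0)) : ℤ) : ℝ) := by
      intro k hk x
      rcases lt_or_gt_of_ne hk with h | h
      · have hm := (hs k).2 h
        have hm' : (M k : ℝ) ≤ 0 := by exact_mod_cast hm
        have h' : (σ k).val < k.val := h
        rw [abs_of_nonpos hm', min_eq_right (by omega), max_eq_left (by omega)]
        simp only [rootR, Pi.smul_apply, smul_eq_mul]; push_cast; ring
      · have hm := (hs k).1 h
        have hm' : (0 : ℝ) ≤ M k := by exact_mod_cast hm
        have h' : k.val < (σ k).val := h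
        rw [abs_of_nonneg hm', min_eq_left (by omega), max_eq_right (by omega)]
        simp only [rootR, Pi.smul_apply, smul_eq_mul]; push_cast; ring
    ext x
    rw [Finset.sum_apply, Finset.sum_congr rfl (fun k hk => h1 k (Finset.mem_filter.1 hk).2 x),
      ← Int.cast_sum, Int.cast_inj, Finset.sum_subset (Finset.subset_univ _)]
    · by_cases hx : x ∈ Finset.Icc 1 n
      · simp only [Finset.mem_Icc] at hx
        obtain ⟨y, rfl⟩ : ∃ y : Fin n, x = y.val + 1 := ⟨⟨x - 1, by omega⟩, by simp; omega⟩
        rw [cyc_sum σ M y]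
        have := hM (σ.symm y)
        simpa using this
      · rw [h0 x hx]
        symm
        apply Finset.sum_eq_zero
        intro k _
        simp only [Finset.mem_Icc] at hx
        have := k.2
        have := (σ k).2
        rw [if_neg (by omega), if_neg (by omega)]; simp
    · intro k _ hk
      by_cases hfix : σ k = k
      · simp [hfix]
      · have : k = i ∨ k = j := by
          by_contra hh
          push Not at hh
          apply hk
          simp [hh, hfix]
        rcases this with rfl | rfl
        · rcases hi with h | h
          · simp [h]
          · exact absurd h hfix
        · rcases hj with h | h
          · simp [h]
          · exact absurd h hfix
  rw [key]
  apply sing_of_sum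
  · intros; positivity
  · intro k hk
    have hk := (Finset.mem_filter.1 hk).2
    have h' : (σ k).val ≠ k.val := fun h => hk (Fin.ext h)
    refine ⟨_, _, ?_, ?_, ?_, rfl⟩ <;> omega
  · refine (Finset.card_filter_le _ _).trans ?_
    rw [Finset.card_erase_of_mem (by simp [hij.symm]), Finset.card_erase_of_mem (by simp)]
    simp; omega

def Phi (d : ℕ →₀ ℕ) : ℕ → ℤ := fun k => (d k : ℤ) - (if k = 0 then 0 else (d (k - 1) : ℤ))

lemma Phi_zero : Phi 0 = 0 := by
  ext k; simp [Phi]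

lemma Phi_add (d e : ℕ →₀ ℕ) : Phi (d + e) = Phi d + Phi e := by
  ext k
  simp only [Phi, Finsupp.add_apply, Pi.add_apply]
  split_ifs <;> push_cast <;> ring

def PhiHom : (ℕ →₀ ℕ) →+ (ℕ → ℤ) where
  toFun := Phi
  map_zero' := Phi_zero
  map_add' := Phi_add

lemma Phi_inj {d e : ℕ →₀ ℕ} (h : Phi d = Phi e) : d = e := by
  ext k
  induction k with
  | zero =>
    have := congrFun h 0
    simpa [Phi] using this
  | succ k ih =>
    have := congrFun h (k + 1)
    simp only [Phi, Nat.add_sub_cancel, ih] at this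
    simpa using this

lemma Phi_mon {i j : ℕ} (h : i ≤ j) : Phi (mon i j) = rootZ i j := by
  ext k
  simp only [Phi, mon_apply, rootZ]
  split_ifs <;> simp <;> omega

lemma Phi_sum {ι : Type*} (s : Finset ι) (r : ι → ℕ) (v : ι → (ℕ →₀ ℕ)) :
    Phi (∑ i ∈ s, r i • v i) = ∑ i ∈ s, (r i : ℤ) • Phi (v i) := by
  have : ∀ d, Phi d = PhiHom d := fun _ => rfl
  simp only [this, map_sum, map_nsmul]
  simp

lemma S_eq (n : ℕ) (a : ℕ → ℤ) (ha : ∀ i ∈ Finset.Icc 1 (n - 1), 0 ≤ a i) (lam : ℕ → ℤ)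
    (hlam : lam = ∑ i ∈ Finset.Icc 1 (n - 1), a i • rootZ i (i + 1))
    (h0 : ∀ k ∉ Finset.Icc 1 n, lam k = 0) :
    S n lam = ∑ σ : Equiv.Perm (Fin n), ((σ.sign : ℤ) : RatFunc ℚ) *
      Kf (fun i : Fin n => lam (i.val + 1)) σ := by
  classical
  set d : ℕ →₀ ℕ := ∑ i ∈ Finset.Icc 1 (n - 1), (a i).toNat • mon i (i + 1) with hd
  have hPd : Phi d = lam := by
    rw [hd, Phi_sum, hlam]
    apply Finset.sum_congr rfl
    intro i hi
    rw [Phi_mon (by omega), Int.toNat_of_nonneg (ha i hi)]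
  have h1 := congrArg (MvPowerSeries.coeff d) (ps_identity n)
  rw [PSr_prod_coeff (pairs n) (fun p => mon p.1 p.2)
    (fun p hp => mon_ne_zero (Finset.mem_filter.1 hp).2) (fun _ => wt)] at h1
  have hS : S n lam = ∑ᶠ r ∈ {r : ℕ × ℕ → ℕ | (∀ i ∉ pairs n, r i = 0) ∧ ∑ i ∈ pairs n, r i • mon i.1 i.2 = d},
      ∏ p ∈ pairs n, wt (r p) := by
    unfold S
    refine finsum_mem_congr ?_ (fun _ _ => rfl)
    ext r
    have : IsKostant n lam r ↔ ((∀ i ∉ pairs n, r i = 0) ∧ ∑ i ∈ pairs n, r i • mon i.1 i.2 = d) := by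
      unfold IsKostant
      apply and_congr Iff.rfl
      have e : Phi (∑ i ∈ pairs n, r i • mon i.1 i.2) = ∑ p ∈ pairs n, (r p : ℤ) • rootZ p.1 p.2 := by
        rw [Phi_sum]
        apply Finset.sum_congr rfl
        intro p hp
        rw [Phi_mon (le_of_lt (Finset.mem_filter.1 hp).2)]
      rw [← e, ← hPd]
      exact ⟨Phi_inj, fun h => by rw [h]⟩
    simp [this]
  rw [hS, h1, map_sum]
  apply Finset.sum_congr rfl
  intro σ _
  rw [← zsmul_eq_mul, map_zsmul, zsmul_eq_mul, PSr_prod_coeff]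
  · congr 1
    unfold Kf
    refine finsum_mem_congr ?_ (fun _ _ => rfl)
    ext r
    have : ((∀ i ∉ σ.support, r i = 0) ∧ ∑ i ∈ σ.support, r i • ev (i.val + 1) ((σ i).val + 1) = d) ↔
        r ∈ Kset (fun i : Fin n => lam (i.val + 1)) σ := by
      unfold Kset
      apply and_congr Iff.rfl
      have hterm : ∀ i : Fin n, ∀ x, i ∈ σ.support →
          ((r i : ℤ) • Phi (ev (i.val + 1) ((σ i).val + 1))) x =
          Ms σ r i * ((if x = i.val + 1 then 1 else 0) - (if x = (σ i).val + 1 then 1 else 0)) := by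
        intro i x hi
        have hi' : σ i ≠ i := Equiv.Perm.mem_support.1 hi
        unfold ev Ms
        rw [Phi_mon (by omega)]
        rcases lt_or_gt_of_ne hi' with h | h
        · have h' : (σ i).val < i.val := h
          rw [if_neg (not_lt_of_gt h), min_eq_right (by omega), max_eq_left (by omega)]
          simp only [rootZ, Pi.smul_apply, smul_eq_mul]; ring
        · have h' : i.val < (σ i).val := h
          rw [if_pos h, min_eq_left (by omega), max_eq_right (by omega)]
          simp only [rootZ, Pi.smul_apply, smul_eq_mul]
      have hx : ∀ x, Phi (∑ i ∈ σ.support, r i • ev (i.val + 1) ((σ i).val + 1)) x =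
          ∑ i, Ms σ r i * ((if x = i.val + 1 then 1 else 0) - (if x = (σ i).val + 1 then 1 else 0)) := by
        intro x
        rw [Phi_sum, Finset.sum_apply, Finset.sum_congr rfl (fun i hi => hterm i x hi)]
        apply Finset.sum_subset (Finset.subset_univ _)
        intro i _ hi
        have : σ i = i := by simpa using hi
        simp [this]
      have hy : ∀ y : Fin n, Phi (∑ i ∈ σ.support, r i • ev (i.val + 1) ((σ i).val + 1)) (y.val + 1) =
          Ms σ r y - Ms σ r (σ.symm y) := by
        intro y; rw [hx, cyc_sum]
      constructor
      · intro h i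
        have := hy (σ i)
        rw [h, hPd] at this
        simpa using this
      · intro h
        apply Phi_inj
        rw [hPd]
        ext x
        by_cases hxm : x ∈ Finset.Icc 1 n
        · simp only [Finset.mem_Icc] at hxm
          obtain ⟨y, rfl⟩ : ∃ y : Fin n, x = y.val + 1 := ⟨⟨x - 1, by omega⟩, by simp; omega⟩
          rw [hy]
          have := h (σ.symm y)
          simpa using this.symm
        · rw [h0 x hxm, hx]
          apply Finset.sum_eq_zero
          intro k _
          simp only [Finset.mem_Icc] at hxm
          have := k.2
          have := (σ k).2
          rw [if_neg (by omega), if_neg (by omega)]; simp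
    simp [← this]
  · intro i hi
    have hi' : σ i ≠ i := Equiv.Perm.mem_support.1 hi
    have : (σ i).val ≠ i.val := fun h => hi' (Fin.ext h)
    apply mon_ne_zero
    omega

noncomputable def sgR (W : Equiv.Perm ℕ) (k : ℕ) : ℝ := if W k < W (k + 1) then 1 else -1

def PR {R : Type*} [AddCommMonoid R] (W : Equiv.Perm ℕ) (v : ℕ → R) (k : ℕ) : R :=
  ∑ j ∈ Finset.Icc 1 k, v (W j)

lemma sgR_sq (W : Equiv.Perm ℕ) (k : ℕ) : sgR W k * sgR W k = 1 := by
  unfold sgR; split_ifs <;> norm_num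

lemma absRoot_apply (W : Equiv.Perm ℕ) (i y : ℕ) :
    absRoot W i (W y) = sgR W i * ((if y = i then 1 else 0) - (if y = i + 1 then 1 else 0)) := by
  have hne : W i ≠ W (i + 1) := fun h => by have := W.injective h; omega
  unfold absRoot rootR sgR
  rcases lt_or_gt_of_ne hne with h | h
  · rw [min_eq_left h.le, max_eq_right h.le, if_pos h]
    simp [W.injective.eq_iff]
  · rw [min_eq_right h.le, max_eq_left h.le, if_neg (not_lt_of_gt h)]
    simp [W.injective.eq_iff]

lemma SB_mem {n : ℕ} {W : Equiv.Perm ℕ} (hW : W ∈ SB 1 n) (j : ℕ) :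
    W j ∈ Finset.Icc 1 n ↔ j ∈ Finset.Icc 1 n := by
  constructor
  · intro h
    by_contra hj
    have := hW j hj
    rw [this] at h
    exact hj h
  · intro h
    by_contra hj
    have := W.injective (hW (W j) hj)
    rw [this] at hj
    exact hj h

lemma PR_full {R : Type*} [AddCommMonoid R] {n : ℕ} {W : Equiv.Perm ℕ} (hW : W ∈ SB 1 n) (v : ℕ → R) :
    PR W v n = ∑ j ∈ Finset.Icc 1 n, v j := by
  unfold PR
  exact Finset.sum_equiv W (fun j => (SB_mem hW j).symm) (fun _ _ => rfl)

lemma PR_succ {R : Type*} [AddCommMonoid R] (W : Equiv.Perm ℕ) (v : ℕ → R) (k : ℕ) :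
    PR W v (k + 1) = PR W v k + v (W (k + 1)) := by
  unfold PR
  rw [Finset.sum_Icc_succ_top (by omega)]

lemma conePos_supp {n : ℕ} {v : ℕ → ℝ} (hv : v ∈ conePos n) :
    (∀ k ∉ Finset.Icc 1 n, v k = 0) ∧ ∑ j ∈ Finset.Icc 1 n, v j = 0 := by
  obtain ⟨T, hT, c, -, rfl⟩ := hv
  constructor
  · intro k hk
    rw [Finset.sum_apply]
    apply Finset.sum_eq_zero
    intro x hx
    obtain ⟨i, j, h1, h2, h3, rfl⟩ := hT hx
    simp only [Finset.mem_Icc] at hk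
    simp only [rootR, Pi.smul_apply]
    rw [if_neg (by omega), if_neg (by omega)]; simp
  · simp only [Finset.sum_apply]
    rw [Finset.sum_comm]
    apply Finset.sum_eq_zero
    intro x hx
    obtain ⟨i, j, h1, h2, h3, rfl⟩ := hT hx
    simp only [rootR, Pi.smul_apply, smul_eq_mul, ← Finset.mul_sum, Finset.sum_sub_distrib]
    simp only [Finset.sum_ite_eq', Finset.mem_Icc]
    rw [if_pos (by omega), if_pos (by omega)]; simp

lemma cone_PR {n : ℕ} (W : Equiv.Perm ℕ) (c : ℕ → ℝ) (k : ℕ) (hk : k ∈ Finset.Icc 1 (n - 1)) :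
    PR W (∑ i ∈ Finset.Icc 1 (n - 1), c i • absRoot W i) k = sgR W k * c k := by
  unfold PR
  simp only [Finset.sum_apply, Pi.smul_apply, smul_eq_mul, absRoot_apply]
  rw [Finset.sum_comm, Finset.sum_eq_single_of_mem k hk]
  · simp only [← Finset.mul_sum, Finset.sum_sub_distrib, Finset.sum_ite_eq', Finset.mem_Icc]
    simp only [Finset.mem_Icc] at hk
    rw [if_pos (by omega), if_neg (by omega)]; ring
  · intro i hi hik
    simp only [← Finset.mul_sum, Finset.sum_sub_distrib, Finset.sum_ite_eq', Finset.mem_Icc]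
    simp only [Finset.mem_Icc] at hk hi
    by_cases h : i < k
    · rw [if_pos (by omega), if_pos (by omega)]; ring
    · rw [if_neg (by omega), if_neg (by omega)]; ring

lemma cone_expand {n : ℕ} {W : Equiv.Perm ℕ} (hW : W ∈ SB 1 n) {v : ℕ → ℝ} (hv : v ∈ conePos n) :
    v = ∑ i ∈ Finset.Icc 1 (n - 1), (sgR W i * PR W v i) • absRoot W i := by
  obtain ⟨h0, hs⟩ := conePos_supp hv
  rw [← PR_full hW] at hs
  ext x
  obtain ⟨y, rfl⟩ := W.surjective x
  simp only [Finset.sum_apply, Pi.smul_apply, smul_eq_mul, absRoot_apply]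
  have e : ∀ i, sgR W i * PR W v i * (sgR W i * ((if y = i then 1 else 0) - (if y = i + 1 then 1 else 0))) =
      (if y = i then PR W v i else 0) - (if y = i + 1 then PR W v (y - 1) else 0) := by
    intro i
    have : sgR W i * PR W v i * (sgR W i * ((if y = i then 1 else 0) - (if y = i + 1 then 1 else 0))) =
      (sgR W i * sgR W i) * (PR W v i * ((if y = i then 1 else 0) - (if y = i + 1 then 1 else 0))) := by ring
    rw [this, sgR_sq]
    by_cases h1 : y = i
    · simp [h1]
    · by_cases h2 : y = i + 1
      · simp [h2]
      · simp [h1, h2]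
  simp only [e, Finset.sum_sub_distrib, Finset.sum_ite_eq]
  have e2 : ∑ i ∈ Finset.Icc 1 (n - 1), (if y = i + 1 then PR W v (y - 1) else 0) =
      if 2 ≤ y ∧ y ≤ n then PR W v (y - 1) else 0 := by
    split_ifs with h
    · rw [Finset.sum_eq_single_of_mem (y - 1) (by simp; omega)]
      · rw [if_pos (by omega)]
      · intro b _ hb
        rw [if_neg (by omega)]
    · apply Finset.sum_eq_zero
      intro i hi
      simp only [Finset.mem_Icc] at hi
      rw [if_neg (by omega)]
  rw [e2]
  by_cases hy : y ∈ Finset.Icc 1 n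
  · simp only [Finset.mem_Icc] at hy ⊢
    obtain ⟨z, rfl⟩ : ∃ z, y = z + 1 := ⟨y - 1, by omega⟩
    have hsucc := PR_succ W v z
    have h1 : (if 1 ≤ z + 1 ∧ z + 1 ≤ n - 1 then PR W v (z + 1) else 0) = PR W v (z + 1) := by
      split_ifs with h
      · rfl
      · rw [show z + 1 = n by omega, hs]
    have h2 : (if 2 ≤ z + 1 ∧ z + 1 ≤ n then PR W v (z + 1 - 1) else 0) = PR W v z := by
      split_ifs with h
      · rfl
      · rw [show z = 0 by omega]; simp [PR]
    rw [h1, h2, hsucc]; ring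
  · rw [h0 _ (fun h => hy ((SB_mem hW y).1 h))]
    simp only [Finset.mem_Icc] at hy ⊢
    rw [if_neg (by omega), if_neg (by omega)]; simp

lemma mem_Cone_iff {n : ℕ} {W : Equiv.Perm ℕ} (hW : W ∈ SB 1 n) {v : ℕ → ℝ} (hv : v ∈ conePos n) :
    v ∈ Cone n W ↔ ∀ k ∈ Finset.Icc 1 (n - 1), 0 ≤ sgR W k * PR W v k := by
  constructor
  · rintro ⟨c, hc, rfl⟩ k hk
    rw [cone_PR W c k hk, ← mul_assoc, sgR_sq, one_mul]
    exact hc k hk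
  · intro h
    exact ⟨_, h, cone_expand hW hv⟩

lemma cone_reg_pos {n : ℕ} {W : Equiv.Perm ℕ} (hW : W ∈ SB 1 n) {v : ℕ → ℝ} (hv : v ∈ regularSet n)
    (hc : v ∈ Cone n W) : ∀ k ∈ Finset.Icc 1 (n - 1), 0 < sgR W k * PR W v k := by
  have h := (mem_Cone_iff hW hv.1).1 hc
  intro k hk
  refine lt_of_le_of_ne (h k hk) ?_
  intro h0
  apply hv.2
  rw [cone_expand hW hv.1, ← Finset.add_sum_erase _ _ hk, ← h0, zero_smul, zero_add]
  apply sing_of_sum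
  · intro i hi
    exact h i (Finset.mem_of_mem_erase hi)
  · intro i hi
    have hi := Finset.mem_of_mem_erase hi
    simp only [Finset.mem_Icc] at hi
    have hne : W i ≠ W (i + 1) := fun h => by have := W.injective h; omega
    have h1 := (SB_mem hW i).2 (by simp; omega)
    have h2 := (SB_mem hW (i + 1)).2 (by simp; omega)
    simp only [Finset.mem_Icc] at h1 h2
    refine ⟨_, _, ?_, ?_, ?_, rfl⟩ <;> omega
  · rw [Finset.card_erase_of_mem hk]; simp; omega

lemma PR_cont (W : Equiv.Perm ℕ) (k : ℕ) : Continuous (fun v : ℕ → ℝ => sgR W k * PR W v k) := by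
  unfold PR
  fun_prop

lemma chamber_iff {n : ℕ} {W : Equiv.Perm ℕ} (hW : W ∈ SB 1 n) {cc : Set (ℕ → ℝ)}
    (hreg : cc ⊆ regularSet n) (hpre : IsPreconnected cc) {v : ℕ → ℝ} (hv : v ∈ cc) :
    cc ⊆ Cone n W ↔ v ∈ Cone n W := by
  constructor
  · intro h; exact h hv
  · intro h
    have hsub : cc ⊆ {v : ℕ → ℝ | ∀ k ∈ Finset.Icc 1 (n - 1), 0 < sgR W k * PR W v k} := by
      apply IsPreconnected.subset_left_of_subset_union (v := {v : ℕ → ℝ | ∃ k ∈ Finset.Icc 1 (n - 1), sgR W k * PR W v k < 0}) _ _ _ _ _ hpre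
      · have : {v : ℕ → ℝ | ∀ k ∈ Finset.Icc 1 (n - 1), 0 < sgR W k * PR W v k} =
          ⋂ k ∈ Finset.Icc 1 (n - 1), {v | 0 < sgR W k * PR W v k} := by ext; simp
        rw [this]
        exact isOpen_biInter_finset (fun k _ => isOpen_lt continuous_const (PR_cont W k))
      · have : {v : ℕ → ℝ | ∃ k ∈ Finset.Icc 1 (n - 1), sgR W k * PR W v k < 0} =
          ⋃ k ∈ Finset.Icc 1 (n - 1), {v | sgR W k * PR W v k < 0} := by ext; simp
        rw [this]
        exact isOpen_biUnion (fun k _ => isOpen_lt (PR_cont W k) continuous_const)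
      · rw [Set.disjoint_left]
        rintro x hx ⟨k, hk, h2⟩
        have := hx k hk
        linarith
      · intro x hx
        by_cases hxc : x ∈ Cone n W
        · exact Or.inl (cone_reg_pos hW (hreg hx) hxc)
        · right
          rw [mem_Cone_iff hW (hreg hx).1] at hxc
          push Not at hxc
          exact hxc
      · exact ⟨v, hv, cone_reg_pos hW (hreg hv) h⟩
    intro x hx
    rw [mem_Cone_iff hW (hreg hx).1]
    intro k hk
    exact (hsub hx k hk).le

def finIcc (n : ℕ) : Fin n ≃ {k : ℕ // k ∈ Finset.Icc 1 n} where
  toFun i := ⟨i.val + 1, Finset.mem_Icc.2 ⟨by omega, i.2⟩⟩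
  invFun k := ⟨k.1 - 1, by have := Finset.mem_Icc.1 k.2; omega⟩
  left_inv i := by simp
  right_inv k := by
    have := k.2
    simp only [Finset.mem_Icc] at this
    apply Subtype.ext
    simp; omega

def extW {n : ℕ} (w : Equiv.Perm (Fin n)) : Equiv.Perm ℕ := w.extendDomain (finIcc n)

lemma extW_apply {n : ℕ} (w : Equiv.Perm (Fin n)) (i : Fin n) : extW w (i.val + 1) = (w i).val + 1 :=
  Equiv.Perm.extendDomain_apply_image w (finIcc n) i

lemma extW_SB {n : ℕ} (w : Equiv.Perm (Fin n)) : extW w ∈ SB 1 n := by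
  intro k hk
  exact Equiv.Perm.extendDomain_apply_not_subtype w (finIcc n) hk

lemma extW_inj {n : ℕ} : Function.Injective (extW (n := n)) := by
  intro w w' h
  ext i
  have := congrArg (fun W : Equiv.Perm ℕ => W (i.val + 1)) h
  simp only [extW_apply] at this
  omega

lemma extW_surj {n : ℕ} {W : Equiv.Perm ℕ} (hW : W ∈ SB 1 n) : ∃ w : Equiv.Perm (Fin n), extW w = W := by
  refine ⟨(finIcc n).permCongr.symm (W.subtypePerm (p := fun k => k ∈ Finset.Icc 1 n) (SB_mem hW)), ?_⟩
  ext k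
  by_cases hk : k ∈ Finset.Icc 1 n
  · simp only [Finset.mem_Icc] at hk
    obtain ⟨y, rfl⟩ : ∃ y : Fin n, k = y.val + 1 := ⟨⟨k - 1, by omega⟩, by simp; omega⟩
    rw [extW_apply]
    have h1 := (SB_mem hW (y.val + 1)).2 (by simp)
    simp only [Finset.mem_Icc] at h1
    simp [finIcc, Equiv.permCongr]
    omega
  · rw [extW_SB _ k hk, hW k hk]

open Classical in
lemma finsum_Wc {n : ℕ} (cc : Set (ℕ → ℝ)) (g : Equiv.Perm ℕ → RatFunc ℚ) :
    ∑ᶠ W ∈ Wc n cc, g W = ∑ w : Equiv.Perm (Fin n), if cc ⊆ Cone n (extW w) then g (extW w) else 0 := by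
  rw [← finsum_eq_sum_of_fintype]
  have : Wc n cc = extW '' {w : Equiv.Perm (Fin n) | cc ⊆ Cone n (extW w)} := by
    ext W
    constructor
    · rintro ⟨h1, h2⟩
      obtain ⟨w, rfl⟩ := extW_surj h1
      exact ⟨w, h2, rfl⟩
    · rintro ⟨w, h, rfl⟩
      exact ⟨extW_SB w, h⟩
  rw [this, finsum_mem_image (extW_inj.injOn)]
  apply finsum_congr
  intro w
  rw [finsum_eq_if]
  rfl

lemma D_eq (n : ℕ) {W : Equiv.Perm ℕ} (hW : W ∈ SB 1 n) (a : ℕ → ℤ) :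
    D (n - 1) W a = ∑ k ∈ Finset.Icc 1 n,
      PR W (∑ i ∈ Finset.Icc 1 (n - 1), a i • rootZ i (i + 1)) k := by
  have hinv : ∀ i ∈ Finset.Icc 1 n, W⁻¹ i ∈ Finset.Icc 1 n := by
    intro i hi
    rw [← SB_mem hW]; simpa using hi
  have hcount : ∀ i ∈ Finset.Icc 1 n, ∀ k,
      ∑ j ∈ Finset.Icc 1 k, (if W j = i then (1 : ℤ) else 0) = if W⁻¹ i ≤ k then 1 else 0 := by
    intro i hi k
    have e : ∀ j, (W j = i) ↔ j = W⁻¹ i := fun j => by rw [Equiv.Perm.eq_inv_iff_eq]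
    have := hinv i hi
    simp only [Finset.mem_Icc] at this
    simp only [e, Finset.sum_ite_eq', Finset.mem_Icc, this.1, true_and]
  have hcount2 : ∀ i ∈ Finset.Icc 1 n,
      ∑ k ∈ Finset.Icc 1 n, (if W⁻¹ i ≤ k then (1 : ℤ) else 0) = n + 1 - W⁻¹ i := by
    intro i hi
    have := hinv i hi
    simp only [Finset.mem_Icc] at this
    rw [← Finset.sum_filter]
    have e : (Finset.Icc 1 n).filter (fun k => W⁻¹ i ≤ k) = Finset.Icc (W⁻¹ i) n := by
      ext k; simp only [Finset.mem_filter, Finset.mem_Icc]; omega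
    rw [e]
    simp only [Finset.sum_const, Nat.card_Icc, nsmul_eq_mul, mul_one]
    omega
  unfold D PR
  simp only [Finset.sum_apply, Pi.smul_apply, smul_eq_mul]
  have e1 : ∀ k ∈ Finset.Icc 1 n, ∑ j ∈ Finset.Icc 1 k, ∑ i ∈ Finset.Icc 1 (n - 1), a i * rootZ i (i + 1) (W j) =
      ∑ i ∈ Finset.Icc 1 (n - 1), a i * ((if W⁻¹ i ≤ k then 1 else 0) - (if W⁻¹ (i + 1) ≤ k then 1 else 0)) := by
    intro k _
    rw [Finset.sum_comm]
    apply Finset.sum_congr rfl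
    intro i hi
    simp only [Finset.mem_Icc] at hi
    rw [← Finset.mul_sum]
    simp only [rootZ, Finset.sum_sub_distrib]
    rw [hcount i (by simp; omega), hcount (i + 1) (by simp; omega)]
  rw [Finset.sum_congr rfl e1, Finset.sum_comm]
  apply Finset.sum_congr rfl
  intro i hi
  simp only [Finset.mem_Icc] at hi
  rw [← Finset.mul_sum, Finset.sum_sub_distrib, hcount2 i (by simp; omega), hcount2 (i + 1) (by simp; omega)]
  ring

lemma sum_fin_Icc {M : Type*} [AddCommMonoid M] (n : ℕ) (f : ℕ → M) :
    ∑ k : Fin n, f (k.val + 1) = ∑ k ∈ Finset.Icc 1 n, f k := by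
  rw [Fin.sum_univ_eq_sum_range (fun k => f (k + 1)) n, Finset.range_eq_Ico,
    Finset.sum_Ico_add' f 0 n 1]
  rfl

lemma fin_succ_val {m : ℕ} (k : Fin (m + 2)) (hk : k ≠ Fin.last (m + 1)) : (k + 1).val = k.val + 1 := by
  rw [Fin.val_add_one, if_neg hk]

lemma eps_eq {m : ℕ} (w : Equiv.Perm (Fin (m + 2))) :
    (∏ k ∈ Finset.univ.erase (Fin.last (m + 1)), if w k < w (k + 1) then (-1 : RatFunc ℚ) else 1) =
      (-1) ^ eps (m + 2) (extW w) := by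
  classical
  rw [Finset.prod_ite]
  simp only [Finset.prod_const, one_pow, mul_one]
  congr 1
  unfold eps
  apply Finset.card_bij (fun k _ => k.val + 1)
  · intro k hk
    simp only [Finset.mem_filter, Finset.mem_erase, Finset.mem_univ, and_true] at hk
    have h1 := fin_succ_val k hk.1
    have h2 := (k + 1).2
    rw [h1] at h2
    have h3 : (w k).val < (w (k + 1)).val := hk.2
    simp only [Finset.mem_filter, Finset.mem_Icc]
    refine ⟨by omega, ?_⟩
    rw [← h1, extW_apply, h1, extW_apply]
    omega
  · intro k _ k' _ h
    ext; omega
  · intro k hk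
    simp only [Finset.mem_filter, Finset.mem_Icc] at hk
    obtain ⟨y, rfl⟩ : ∃ y : Fin (m + 2), k = y.val + 1 := ⟨⟨k - 1, by omega⟩, by simp; omega⟩
    have hy : y ≠ Fin.last (m + 1) := by
      intro h; rw [h] at hk; simp at hk
    refine ⟨y, ?_, rfl⟩
    have h1 := fin_succ_val y hy
    simp only [Finset.mem_filter, Finset.mem_erase, Finset.mem_univ, and_true]
    refine ⟨hy, ?_⟩
    have h3 := hk.2
    rw [extW_apply, ← h1, extW_apply] at h3
    show (w y).val < (w (y + 1)).val
    omega

lemma PR_cast (W : Equiv.Perm ℕ) (lam : ℕ → ℤ) (k : ℕ) :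
    PR W (fun k => (lam k : ℝ)) k = ((PR W lam k : ℤ) : ℝ) := by
  unfold PR; push_cast; rfl

theorem trace_residue_formula_big_chamber (n : ℕ) (hn : 2 ≤ n)
    (cc : Set (ℕ → ℝ)) (hcc : ∃ x ∈ regularSet n, connectedComponentIn (regularSet n) x = cc)
    (a : ℕ → ℤ) (ha : ∀ i ∈ Finset.Icc 1 (n - 1), 0 ≤ a i)
    (hmem : (fun k => ((∑ i ∈ Finset.Icc 1 (n - 1), a i • rootZ i (i + 1)) k : ℝ)) ∈ cc) :
    S n (∑ i ∈ Finset.Icc 1 (n - 1), a i • rootZ i (i + 1)) =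
        (∏ p ∈ pairs n, Omega p.1 p.2) *
          ∑ᶠ w ∈ Wc n cc, (-1 : RatFunc ℚ) ^ eps n w * q ^ (-D (n - 1) w a) ∧
      (∏ p ∈ pairs n, Omega p.1 p.2) = (q - 1) ^ n / (q ^ n - 1) := by
  classical
  obtain ⟨m, rfl⟩ : ∃ m, n = m + 2 := ⟨n - 2, by omega⟩
  have hO := omega_prod (m + 1)
  refine ⟨?_, hO⟩
  obtain ⟨x, hx, rfl⟩ := hcc
  set cc := connectedComponentIn (regularSet (m + 2)) x with hccdef
  have hreg : cc ⊆ regularSet (m + 2) := connectedComponentIn_subset _ _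
  have hpre : IsPreconnected cc := isPreconnected_connectedComponentIn
  set lam : ℕ → ℤ := ∑ i ∈ Finset.Icc 1 (m + 2 - 1), a i • rootZ i (i + 1) with hlam
  have hlr := hreg hmem
  obtain ⟨h0', hsum'⟩ := conePos_supp hlr.1
  have h0 : ∀ k ∉ Finset.Icc 1 (m + 2), lam k = 0 := by
    intro k hk
    exact_mod_cast h0' k hk
  have hsum : ∑ j ∈ Finset.Icc 1 (m + 2), lam j = 0 := by exact_mod_cast hsum'
  have hfull : ∀ w : Equiv.Perm (Fin (m + 2)), PR (extW w) lam (m + 2) = 0 := by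
    intro w
    rw [PR_full (extW_SB w), hsum]
  have hL := notSing_of_regular (m + 2) lam h0 hlr.2
  have hcore := core (fun i : Fin (m + 2) => lam (i.val + 1)) hL
    (fun w k => PR (extW w) lam (k.val + 1))
    (by
      intro w k
      show PR (extW w) lam ((k + 1).val + 1) = PR (extW w) lam (k.val + 1) + lam ((w (k + 1)).val + 1)
      rw [← extW_apply, PR_succ]
      by_cases hk : k = Fin.last (m + 1)
      · subst hk
        have : (Fin.last (m + 1) + 1).val = 0 := by simp
        rw [this]
        have h2 := hfull w
        simp only [Fin.val_last]
        rw [h2]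
        simp [PR]
      · rw [fin_succ_val k hk])
    (by
      intro w
      simpa using hfull w)
  rw [S_eq (m + 2) a ha lam hlam h0, hcore, hO, finsum_Wc]
  congr 1
  apply Finset.sum_congr rfl
  intro w _
  unfold gterm
  rw [eps_eq, sum_fin_Icc (m + 2) (fun k => PR (extW w) lam k), ← D_eq (m + 2) (extW_SB w) a]
  refine if_congr ?_ rfl rfl
  rw [chamber_iff (extW_SB w) hreg hpre hmem, mem_Cone_iff (extW_SB w) hlr.1]
  have hone : ∀ k : Fin (m + 2), k ≠ Fin.last (m + 1) →
      (((w k < w (k + 1) → 0 ≤ PR (extW w) lam (k.val + 1)) ∧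
        (¬ w k < w (k + 1) → PR (extW w) lam (k.val + 1) ≤ 0)) ↔
      0 ≤ sgR (extW w) (k.val + 1) * PR (extW w) (fun k => (lam k : ℝ)) (k.val + 1)) := by
    intro k hk
    have h1 := fin_succ_val k hk
    have h2 : (extW w (k.val + 1) < extW w (k.val + 1 + 1)) ↔ w k < w (k + 1) := by
      rw [extW_apply, ← h1, extW_apply, Fin.lt_def]
      omega
    rw [PR_cast]
    unfold sgR
    simp only [h2]
    by_cases hw : w k < w (k + 1)
    · simp [hw]
    · simp [hw]
  constructor
  · intro h k hk
    simp only [Finset.mem_Icc] at hk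
    obtain ⟨y, rfl⟩ : ∃ y : Fin (m + 2), k = y.val + 1 := ⟨⟨k - 1, by omega⟩, by simp; omega⟩
    have hy : y ≠ Fin.last (m + 1) := by
      intro h; rw [h] at hk; simp at hk
    exact (hone y hy).1 (h y)
  · intro h k
    by_cases hk : k = Fin.last (m + 1)
    · subst hk
      have := hfull w
      simp only [Fin.val_last]
      rw [this]
      simp
    · apply (hone k hk).2
      apply h
      have h1 := fin_succ_val k hk
      have h2 := (k + 1).2
      rw [h1] at h2
      simp only [Finset.mem_Icc]
      omega
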